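/- For every x₀ ∈ Ω and ρ > 0 with D(x₀,ρ) ⊂ Ω and all radii 0 < r₀ ≤ r₁ ≤ ρ, one has ζ_⋆(D(x₀,r₁))/r₁ ≥ ζ_⋆(D(x₀,r₀))/r₀. Consequently, for every x₀ ∈ Ω the limit Θ_⋆(x₀) = lim_{r→0} ζ_⋆(D(x₀,r))/r exists, and Θ_⋆(x₀) ≤ ζ_⋆(D(x₀,ρ))/ρ ≤ M₀/dist(x₀,∂Ω). -/

import Mathlib

open MeasureTheory Metric Filter Topology Bornology
open scoped RealInnerProductSpace ENNReal Topology

noncomputable section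

/-- The euclidean plane. -/
abbrev E2 : Type := EuclideanSpace ℝ (Fin 2)

/-- The euclidean space `ℝ^k`. -/
abbrev Evec (k : ℕ) : Type := EuclideanSpace ℝ (Fin k)

/-- The `i`-th standard basis vector of the plane. -/
def b2 (i : Fin 2) : E2 := EuclideanSpace.single i (1 : ℝ)

/-- The partial derivative of `u` in the `i`-th coordinate direction. -/
def pder {k : ℕ} (u : E2 → Evec k) (i : Fin 2) (x : E2) : Evec k :=
  fderiv ℝ u x (b2 i)

/-- The Laplacian of a map defined on the plane. -/
def lap {k : ℕ} (u : E2 → Evec k) (x : E2) : Evec k :=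
  ∑ i : Fin 2, fderiv ℝ (pder u i) x (b2 i)

/-- `u` is a smooth solution of the vectorial Allen-Cahn system
`Δu = ε⁻² ∇V(u)` on the open set `U`. -/
def IsSolution {k : ℕ} (V : Evec k → ℝ) (ε : ℝ) (U : Set E2) (u : E2 → Evec k) : Prop :=
  ContDiffOn ℝ (⊤ : ℕ∞) u U ∧ ∀ x ∈ U, lap u x = (ε ^ 2)⁻¹ • gradient V (u x)

/-- The squared modulus `|∇u|²` of the full gradient. -/
def gradSq {k : ℕ} (u : E2 → Evec k) (x : E2) : ℝ :=
  ∑ i : Fin 2, ‖pder u i x‖ ^ 2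

/-- The energy density `e_ε(u) = (ε/2)|∇u|² + ε⁻¹ V(u)`. -/
def eDens {k : ℕ} (V : Evec k → ℝ) (ε : ℝ) (u : E2 → Evec k) (x : E2) : ℝ :=
  ε / 2 * gradSq u x + ε⁻¹ * V (u x)

/-- The energy `E_ε(u, G)`. -/
def energy {k : ℕ} (V : Evec k → ℝ) (ε : ℝ) (u : E2 → Evec k) (G : Set E2) : ℝ :=
  ∫ x in G, eDens V ε u x

/-- The hypotheses (H₁), (H₂), (H₃) on the multi-well potential `V`:
smooth, nonnegative with `inf V = 0`, finitely many zeros (at least two),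
positive definite Hessian at each zero, quadratic growth of `y·∇V(y)` at
infinity and coercivity. -/
structure IsMultiWell {k : ℕ} (V : Evec k → ℝ) : Prop where
  smooth : ContDiff ℝ (⊤ : ℕ∞) V
  nonneg : ∀ y, 0 ≤ V y
  finite_zeros : {y : Evec k | V y = 0}.Finite
  two_le_card : 2 ≤ {y : Evec k | V y = 0}.ncard
  hess_posdef : ∀ σ : Evec k, V σ = 0 → ∀ w : Evec k, w ≠ 0 →
    0 < iteratedFDeriv ℝ 2 V σ ![w, w]
  growth : ∃ α > (0 : ℝ), ∃ R > (0 : ℝ), ∀ y : Evec k, R < ‖y‖ →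
    α * ‖y‖ ^ 2 ≤ ⟪y, gradient V y⟫
  coercive : ∀ C : ℝ, ∃ R : ℝ, ∀ y : Evec k, R ≤ ‖y‖ → C ≤ V y

/-- A continuous test function compactly supported in `Ω`. -/
def TestFun (Ω : Set E2) (f : E2 → ℝ) : Prop :=
  Continuous f ∧ HasCompactSupport f ∧ tsupport f ⊆ Ω

/-- The lower one-dimensional density of the measure `ν` at `x`. -/
def densLow (ν : Measure E2) (x : E2) : ℝ :=
  Filter.liminf (fun r : ℝ => (ν (closedBall x r)).toReal / r) (𝓝[>] 0)

/-- The concentration set `𝔖⋆ = {x ∈ Ω | liminf_{r→0} ν(D̄(x,r))/r ≥ η}`. -/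
def concSet (ν : Measure E2) (Ω : Set E2) (η : ℝ) : Set E2 :=
  {x ∈ Ω | η ≤ densLow ν x}

theorem second_fderiv_nonneg_of_isLocalMin {E : Type*} [NormedAddCommGroup E] [NormedSpace ℝ E]
    {W : E → ℝ} {y : E} (hW : ContDiff ℝ 2 W) (hmin : IsLocalMin W y) (v : E) :
    0 ≤ fderiv ℝ (fderiv ℝ W) y v v := by
  have hline : ∀ t : ℝ, HasDerivAt (fun t : ℝ => y + t • v) v t := fun t => by
    simpa using ((hasDerivAt_id t).smul_const v).const_add y
  have hW1 : Differentiable ℝ W := hW.differentiable (by norm_num)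
  have hW2 : Differentiable ℝ (fderiv ℝ W) :=
    (hW.fderiv_right (m := 1) (by norm_num)).differentiable (by norm_num)
  have hd1 : deriv (fun t : ℝ => W (y + t • v)) = fun t => fderiv ℝ W (y + t • v) v := by
    funext t
    exact ((hW1 _).hasFDerivAt.comp_hasDerivAt t (hline t)).deriv
  have hd2 : deriv (deriv fun t : ℝ => W (y + t • v)) 0 = fderiv ℝ (fderiv ℝ W) y v v := by
    rw [hd1]
    have h1 := (hW2 (y + (0 : ℝ) • v)).hasFDerivAt.comp_hasDerivAt (0 : ℝ) (hline 0)
    have h2 := h1.clm_apply (hasDerivAt_const (0 : ℝ) v)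
    simpa using h2.deriv
  have hmin' : IsLocalMin (fun t : ℝ => W (y + t • v)) 0 := by
    have hc : ContinuousAt (fun t : ℝ => y + t • v) 0 := (hline 0).continuousAt
    have := hc.tendsto
    simp only [zero_smul, add_zero] at this
    have h := this.eventually hmin
    unfold IsLocalMin IsMinFilter
    simpa using h
  by_contra hneg
  push Not at hneg
  rw [← hd2] at hneg
  have hmax := isLocalMax_of_deriv_deriv_neg hneg hmin'.deriv_eq_zero
    ((hW1 _).continuousAt.comp (hline 0).continuousAt)
  have hconst : (fun t : ℝ => W (y + t • v)) =ᶠ[𝓝 0] fun _ => W (y + (0 : ℝ) • v) := by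
    filter_upwards [hmax, hmin'] with t h1 h2
    exact le_antisymm h1 h2
  have h3 := hconst.deriv.deriv_eq
  simp only [deriv_const'] at h3
  rw [h3] at hneg
  exact lt_irrefl _ hneg

theorem abs_taylor_le_of_lipschitz_fderiv {E : Type*} [NormedAddCommGroup E] [NormedSpace ℝ E]
    {g : E → ℝ} (hg : Differentiable ℝ g) {x : E} {r Λ : ℝ}
    (hL : ∀ y ∈ closedBall x r, ∀ z ∈ closedBall x r,
      ‖fderiv ℝ g y - fderiv ℝ g z‖ ≤ Λ * ‖y - z‖) {y z : E}
    (hΛ : 0 ≤ Λ) (hy : y ∈ closedBall x r) (hz : z ∈ closedBall x r) :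
    |g y - g z - fderiv ℝ g z (y - z)| ≤ Λ * ‖y - z‖ ^ 2 := by
  have h := (convex_segment z y).norm_image_sub_le_of_norm_fderiv_le' (𝕜 := ℝ) (f := g)
    (φ := fderiv ℝ g z) (C := Λ * ‖y - z‖) (x := z) (y := y) (fun w _ => hg w)
    (fun w hw => (hL w ((convex_closedBall x r).segment_subset hz hy hw) z hz).trans (by
      gcongr
      rw [← dist_eq_norm, ← dist_eq_norm]
      have := dist_add_dist_of_mem_segment hw
      have h0 : 0 ≤ dist w y := dist_nonneg
      rw [dist_comm w z, dist_comm y z]; linarith))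
    (left_mem_segment ℝ z y) (right_mem_segment ℝ z y)
  rw [Real.norm_eq_abs] at h
  calc _ ≤ _ := h
    _ = _ := by ring

/-- The second derivative of a scalar function on the plane as a bilinear form. -/
def hess (φ : E2 → ℝ) (y : E2) : E2 →L[ℝ] E2 →L[ℝ] ℝ := fderiv ℝ (fderiv ℝ φ) y

/-- The trace of a bilinear form on the plane. -/
def tr2 (B : E2 →L[ℝ] E2 →L[ℝ] ℝ) : ℝ := B (b2 0) (b2 0) + B (b2 1) (b2 1)

/-- The determinant of a bilinear form on the plane. -/
def det2 (B : E2 →L[ℝ] E2 →L[ℝ] ℝ) : ℝ :=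
  B (b2 0) (b2 0) * B (b2 1) (b2 1) - B (b2 0) (b2 1) * B (b2 1) (b2 0)

theorem continuous_bilin_apply (v w : E2) :
    Continuous fun B : E2 →L[ℝ] E2 →L[ℝ] ℝ => B v w :=
  (continuous_id.clm_apply continuous_const).clm_apply continuous_const

theorem continuous_tr2 : Continuous tr2 :=
  (continuous_bilin_apply _ _).add (continuous_bilin_apply _ _)

theorem continuous_det2 : Continuous det2 :=
  ((continuous_bilin_apply _ _).mul (continuous_bilin_apply _ _)).sub
    ((continuous_bilin_apply _ _).mul (continuous_bilin_apply _ _))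

theorem E2_eq_sum (v : E2) : v = v 0 • b2 0 + v 1 • b2 1 := by
  ext i; fin_cases i <;> simp [b2]

/-- The gradient vector of a linear form on the plane. -/
def gradMap : (E2 →L[ℝ] ℝ) →L[ℝ] E2 :=
  ∑ i : Fin 2, (ContinuousLinearMap.apply ℝ ℝ (b2 i)).smulRight (b2 i)

theorem gradMap_apply (L : E2 →L[ℝ] ℝ) : gradMap L = L (b2 0) • b2 0 + L (b2 1) • b2 1 := by
  simp [gradMap]

theorem gradMap_innerSL (p : E2) : gradMap (innerSL ℝ p) = p := by
  rw [gradMap_apply]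
  conv_rhs => rw [E2_eq_sum p]
  simp [b2, EuclideanSpace.inner_single_right]

theorem det_gradMap_comp (B : E2 →L[ℝ] E2 →L[ℝ] ℝ) : (gradMap ∘L B).det = det2 B := by
  rw [ContinuousLinearMap.det, ← LinearMap.det_toMatrix (EuclideanSpace.basisFun (Fin 2) ℝ).toBasis,
    Matrix.det_fin_two]
  simp [LinearMap.toMatrix_apply, gradMap_apply, det2, b2]
  ring

theorem det2_bounds {B : E2 →L[ℝ] E2 →L[ℝ] ℝ} (hpos : ∀ v, 0 ≤ B v v)
    (hsymm : ∀ v w, B v w = B w v) : 0 ≤ det2 B ∧ det2 B ≤ (tr2 B / 2) ^ 2 := by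
  have hs := hsymm (b2 1) (b2 0)
  constructor
  · have h0 := hpos (b2 0)
    have h1 := hpos (b2 1)
    have key : ∀ s t : ℝ, 0 ≤ s ^ 2 * B (b2 0) (b2 0) + 2 * s * t * B (b2 0) (b2 1)
        + t ^ 2 * B (b2 1) (b2 1) := by
      intro s t
      have := hpos (s • b2 0 + t • b2 1)
      simp only [map_add, map_smul, add_apply,
        smul_apply, smul_eq_mul] at this
      rw [hs] at this
      linarith
    unfold det2
    rw [hs]
    rcases h1.eq_or_lt with h | h
    · rcases eq_or_ne (B (b2 0) (b2 1)) 0 with hc | hc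
      · simp [← h, hc]
      · have k := key 1 (-(B (b2 0) (b2 0) + 1) / (2 * B (b2 0) (b2 1)))
        rw [← h] at k
        have e : 2 * 1 * (-(B (b2 0) (b2 0) + 1) / (2 * B (b2 0) (b2 1))) * B (b2 0) (b2 1)
            = -(B (b2 0) (b2 0) + 1) := by field_simp
        rw [e] at k
        linarith
    · have k := key (B (b2 1) (b2 1)) (-B (b2 0) (b2 1))
      have : 0 ≤ B (b2 1) (b2 1) * (B (b2 0) (b2 0) * B (b2 1) (b2 1)
        - B (b2 0) (b2 1) * B (b2 0) (b2 1)) := by linarith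
      exact nonneg_of_mul_nonneg_right this h
  · unfold det2 tr2
    rw [hs]
    nlinarith [sq_nonneg (B (b2 0) (b2 0) - B (b2 1) (b2 1)), sq_nonneg (B (b2 0) (b2 1))]

/-- The vector `e` turned by a right angle. -/
def rot (e : E2) : E2 := !₂[-e 1, e 0]

theorem rot_zero (e : E2) : rot e 0 = -e 1 := rfl
theorem rot_one (e : E2) : rot e 1 = e 0 := rfl

theorem inner_E2 (v w : E2) : ⟪v, w⟫ = v 0 * w 0 + v 1 * w 1 := by
  simp [PiLp.inner_apply, mul_comm]

theorem norm_sq_E2 (v : E2) : ‖v‖ ^ 2 = v 0 ^ 2 + v 1 ^ 2 := by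
  rw [← real_inner_self_eq_norm_sq, inner_E2]; ring

theorem E2_eq_frame {e : E2} (he : ‖e‖ = 1) (v : E2) : v = ⟪e, v⟫ • e + ⟪rot e, v⟫ • rot e := by
  have h : e 0 ^ 2 + e 1 ^ 2 = 1 := by rw [← norm_sq_E2, he]; norm_num
  ext i
  fin_cases i
  · simp [inner_E2, rot_zero, rot_one]
    linear_combination -(v 0) * h
  · simp [inner_E2, rot_zero, rot_one]
    linear_combination -(v 1) * h

theorem norm_sq_frame {e : E2} (he : ‖e‖ = 1) (v : E2) :
    ‖v‖ ^ 2 = ⟪e, v⟫ ^ 2 + ⟪rot e, v⟫ ^ 2 := by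
  have h : e 0 ^ 2 + e 1 ^ 2 = 1 := by rw [← norm_sq_E2, he]; norm_num
  simp only [inner_E2, rot_zero, rot_one, norm_sq_E2]
  linear_combination -(v 0 ^ 2 + v 1 ^ 2) * h

theorem norm_rot {e : E2} (he : ‖e‖ = 1) : ‖rot e‖ = 1 := by
  have h : e 0 ^ 2 + e 1 ^ 2 = 1 := by rw [← norm_sq_E2, he]; norm_num
  have : ‖rot e‖ ^ 2 = 1 := by rw [norm_sq_E2, rot_zero, rot_one]; linarith
  nlinarith [norm_nonneg (rot e)]

theorem inner_rot (e : E2) : ⟪e, rot e⟫ = 0 := by rw [inner_E2, rot_zero, rot_one]; ring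

theorem hasFDerivAt_inner_sub (e x y : E2) :
    HasFDerivAt (fun z : E2 => ⟪e, z - x⟫) (innerSL ℝ e) y := by
  have h := (innerSL ℝ e).hasFDerivAt (x := y - x)
  exact h.comp y ((hasFDerivAt_id y).sub_const x)

/-- A quadratic polynomial in the coordinates `⟪e, y - x⟫` and `⟪f, y - x⟫`. -/
def quadFn (x e f : E2) (a S β C κ : ℝ) (y : E2) : ℝ :=
  a + S * ⟪e, y - x⟫ + β * ⟪f, y - x⟫ + C * ⟪f, y - x⟫ ^ 2 - κ * ⟪e, y - x⟫ ^ 2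

theorem contDiff_quadFn (x e f : E2) (a S β C κ : ℝ) (n : WithTop ℕ∞) :
    ContDiff ℝ n (quadFn x e f a S β C κ) := by
  have he : ∀ e : E2, ContDiff ℝ n fun y : E2 => ⟪e, y - x⟫ := fun e =>
    contDiff_const.inner ℝ (contDiff_id.sub contDiff_const)
  unfold quadFn
  exact ((((contDiff_const).add (contDiff_const.mul (he e))).add (contDiff_const.mul (he f))).add
    (contDiff_const.mul ((he f).pow 2))).sub (contDiff_const.mul ((he e).pow 2))

theorem hasFDerivAt_quadFn (x e f : E2) (a S β C κ : ℝ) (y : E2) :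
    HasFDerivAt (quadFn x e f a S β C κ) (S • innerSL ℝ e + β • innerSL ℝ f
      + (2 * C * ⟪f, y - x⟫) • innerSL ℝ f - (2 * κ * ⟪e, y - x⟫) • innerSL ℝ e) y := by
  have he := hasFDerivAt_inner_sub e x y
  have hf := hasFDerivAt_inner_sub f x y
  have h := ((((he.const_mul S).const_add a).add (hf.const_mul β)).add
    ((hf.pow 2).const_mul C)).sub ((he.pow 2).const_mul κ)
  refine h.congr_fderiv ?_
  ext v
  simp [smul_apply, add_apply]
  ring

theorem hess_quadFn (x e f : E2) (a S β C κ : ℝ) (y v w : E2) :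
    hess (quadFn x e f a S β C κ) y v w
      = 2 * C * ⟪f, v⟫ * ⟪f, w⟫ - 2 * κ * ⟪e, v⟫ * ⟪e, w⟫ := by
  have h1 : fderiv ℝ (quadFn x e f a S β C κ) = fun y => S • innerSL ℝ e + β • innerSL ℝ f
      + (2 * C * ⟪f, y - x⟫) • innerSL ℝ f - (2 * κ * ⟪e, y - x⟫) • innerSL ℝ e := by
    ext1 y
    exact (hasFDerivAt_quadFn x e f a S β C κ y).fderiv
  have he := ((hasFDerivAt_inner_sub e x y).const_mul (2 * κ)).smul_const (innerSL ℝ e)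
  have hf := ((hasFDerivAt_inner_sub f x y).const_mul (2 * C)).smul_const (innerSL ℝ f)
  have h2 := (hf.const_add (S • innerSL ℝ e + β • innerSL ℝ f)).fun_sub he
  unfold hess
  rw [h1, h2.fderiv]
  simp [smul_apply]

theorem tr2_inner_mul {e : E2} (he : ‖e‖ = 1) (c d : ℝ) (f : E2) (hf : ‖f‖ = 1)
    {B : E2 →L[ℝ] E2 →L[ℝ] ℝ} (hB : ∀ v w, B v w = c * ⟪f, v⟫ * ⟪f, w⟫ - d * ⟪e, v⟫ * ⟪e, w⟫) :
    tr2 B = c - d := by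
  have h : e 0 ^ 2 + e 1 ^ 2 = 1 := by rw [← norm_sq_E2, he]; norm_num
  have h' : f 0 ^ 2 + f 1 ^ 2 = 1 := by rw [← norm_sq_E2, hf]; norm_num
  unfold tr2
  rw [hB, hB]
  simp [inner_E2, b2]
  linear_combination c * h' - d * h

/-- Boundary comparison between a function with Lipschitz gradient and a quadratic polynomial on
a square. -/
theorem le_quadFn_of_mem_frontier_square {Λ h δ : ℝ} (hΛ : 0 ≤ Λ) (hδ : 0 < δ)
    {g : E2 → ℝ} (hg : Differentiable ℝ g) {x e : E2} (he : ‖e‖ = 1) {l : ℝ} (hl : 0 < l)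
    (hlh : l ≤ h)
    (hL : ∀ y ∈ closedBall x (2 * h), ∀ z ∈ closedBall x (2 * h),
      ‖fderiv ℝ g y - fderiv ℝ g z‖ ≤ Λ * ‖y - z‖) {y : E2}
    (ht : |⟪e, y - x⟫| ≤ l) (hw : |⟪rot e, y - x⟫| ≤ l)
    (hb : |⟪e, y - x⟫| = l ∨ |⟪rot e, y - x⟫| = l) :
    g y ≤ quadFn x e (rot e) ((g (x + l • e) + g (x - l • e)) / 2 + δ / 4 + δ / (4 * h ^ 2) * l ^ 2)
      ((g (x + l • e) - g (x - l • e)) / (2 * l)) (fderiv ℝ g x (rot e))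
      (Λ ^ 2 * h ^ 2 / δ + 4 * Λ + 1) (δ / (4 * h ^ 2)) y := by
  have hh : 0 < h := hl.trans_le hlh
  set t := ⟪e, y - x⟫ with ht_def
  set w := ⟪rot e, y - x⟫ with hw_def
  set f := rot e with hf_def
  have hf : ‖f‖ = 1 := norm_rot he
  set β := fderiv ℝ g x f
  set S := (g (x + l • e) - g (x - l • e)) / (2 * l) with hS
  set A := (g (x + l • e) + g (x - l • e)) / 2 with hA
  have hy : y - x = t • e + w • f := E2_eq_frame he (y - x)
  have hgp : g (x + l • e) = A + S * l := by rw [hA, hS]; field_simp; ring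
  have hgm : g (x - l • e) = A - S * l := by rw [hA, hS]; field_simp; ring
  have hnorm : ‖y - x‖ ^ 2 = t ^ 2 + w ^ 2 := norm_sq_frame he (y - x)
  have ht2 : t ^ 2 ≤ l ^ 2 := sq_le_sq' (abs_le.1 ht).1 (abs_le.1 ht).2
  have hw2 : w ^ 2 ≤ l ^ 2 := sq_le_sq' (abs_le.1 hw).1 (abs_le.1 hw).2
  have hymem : y ∈ closedBall x (2 * h) := by
    rw [mem_closedBall, dist_eq_norm]
    refine abs_le_of_sq_le_sq' ?_ (by positivity) |>.2
    nlinarith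
  have hxmem : x ∈ closedBall x (2 * h) := mem_closedBall_self (by positivity)
  have hpm : ∀ s : ℝ, |s| = l → x + s • e ∈ closedBall x (2 * h) := by
    intro s hs
    rw [mem_closedBall, dist_eq_norm, add_sub_cancel_left, norm_smul, he, Real.norm_eq_abs, hs]
    linarith
  have hκ : 0 ≤ δ / (4 * h ^ 2) * (l ^ 2 - t ^ 2) := mul_nonneg (by positivity) (by linarith)
  unfold quadFn
  rw [← ht_def, ← hw_def]
  have hP : 0 ≤ Λ ^ 2 * h ^ 2 / δ := by positivity
  rcases hb with hb | hb
  · have hz := hpm t hb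
    have h1 := (abs_le.1 (abs_taylor_le_of_lipschitz_fderiv hg hL hΛ hymem hz)).2
    have hyz : y - (x + t • e) = w • f := by rw [← sub_sub, hy]; abel
    rw [hyz, map_smul, norm_smul, hf, mul_one, Real.norm_eq_abs, sq_abs, smul_eq_mul] at h1
    have h2 : |fderiv ℝ g (x + t • e) f - β| ≤ Λ * l := by
      have := hL _ hz _ hxmem
      rw [add_sub_cancel_left, norm_smul, he, mul_one, Real.norm_eq_abs, hb] at this
      have h3 := (fderiv ℝ g (x + t • e) - fderiv ℝ g x).le_opNorm f
      rw [hf, mul_one] at h3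
      exact h3.trans this
    have h4 : w * fderiv ℝ g (x + t • e) f ≤ w * β + Λ * l * |w| := by
      have : |w * (fderiv ℝ g (x + t • e) f - β)| ≤ |w| * (Λ * l) := by
        rw [abs_mul]; gcongr
      have := (abs_le.1 this).2
      nlinarith
    have h5 : Λ * l * |w| ≤ δ / 4 + Λ ^ 2 * h ^ 2 / δ * w ^ 2 := by
      have h6 : Λ * l * |w| ≤ Λ * h * |w| := by gcongr
      have h7 : δ / 4 + Λ ^ 2 * h ^ 2 / δ * w ^ 2 - Λ * h * |w|
          = (δ / 2 - Λ * h * |w|) ^ 2 / δ := by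
        rw [← sq_abs w]; field_simp; ring
      have : 0 ≤ (δ / 2 - Λ * h * |w|) ^ 2 / δ := by positivity
      linarith
    have h8 : g (x + t • e) = A + S * t := by
      rcases abs_choice t with hc | hc
      · rw [← hc, hb, hgp]
      · have : t = -l := by linarith
        rw [this, neg_smul, ← sub_eq_add_neg, hgm]; ring
    have h9 := mul_nonneg hΛ (sq_nonneg w)
    have h10 := sq_nonneg w
    rw [h8] at h1
    generalize Λ ^ 2 * h ^ 2 / δ = P at *
    generalize δ / (4 * h ^ 2) = K at *
    linarith
  · have h1 := (abs_le.1 (abs_taylor_le_of_lipschitz_fderiv hg hL hΛ hymem hxmem)).2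
    rw [hnorm, hy, map_add, map_smul, map_smul, smul_eq_mul, smul_eq_mul] at h1
    have h2 := abs_le.1 (abs_taylor_le_of_lipschitz_fderiv hg hL hΛ (hpm l (abs_of_pos hl)) hxmem)
    have h3 := abs_le.1 (abs_taylor_le_of_lipschitz_fderiv hg hL hΛ
      (hpm (-l) (by rw [abs_neg, abs_of_pos hl])) hxmem)
    simp only [add_sub_cancel_left, map_smul, norm_smul, he, mul_one, Real.norm_eq_abs, abs_neg,
      abs_of_pos hl, smul_eq_mul] at h2 h3
    rw [neg_smul, ← sub_eq_add_neg, hgm] at h3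
    rw [hgp] at h2
    have hw2' : w ^ 2 = l ^ 2 := by rw [← sq_abs, hb]
    have h4 : |fderiv ℝ g x e - S| ≤ Λ * l := by
      rw [abs_le]
      constructor <;> nlinarith
    have h5 : t * (fderiv ℝ g x e - S) ≤ Λ * l ^ 2 := by
      have : |t * (fderiv ℝ g x e - S)| ≤ l * (Λ * l) := by rw [abs_mul]; gcongr
      have := (abs_le.1 this).2
      linarith
    have h6 := mul_le_mul_of_nonneg_left ht2 hΛ
    have h7 := mul_nonneg hP (sq_nonneg l)
    have h8 := sq_nonneg l
    rw [hw2'] at h1 ⊢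
    generalize Λ ^ 2 * h ^ 2 / δ = P at *
    generalize δ / (4 * h ^ 2) = K at *
    linarith

theorem continuous_hess {φ : E2 → ℝ} (hφ : ContDiff ℝ 2 φ) : Continuous (hess φ) :=
  (hφ.fderiv_right (m := 1) le_rfl).continuous_fderiv one_ne_zero

theorem hasFDerivAt_fderiv {φ : E2 → ℝ} (hφ : ContDiff ℝ 2 φ) (y : E2) :
    HasFDerivAt (fderiv ℝ φ) (hess φ y) y :=
  ((hφ.fderiv_right (m := 1) le_rfl).differentiable one_ne_zero y).hasFDerivAt

theorem hess_symm {φ : E2 → ℝ} (hφ : ContDiff ℝ 2 φ) (y v w : E2) :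
    hess φ y v w = hess φ y w v :=
  (hφ.contDiffAt.isSymmSndFDerivAt (by simp)) v w

theorem hess_sub {φ ψ : E2 → ℝ} (hφ : ContDiff ℝ 2 φ) (hψ : ContDiff ℝ 2 ψ) (y : E2) :
    hess (fun z => φ z - ψ z) y = hess φ y - hess ψ y := by
  have h : fderiv ℝ (fun z => φ z - ψ z) = fun z => fderiv ℝ φ z - fderiv ℝ ψ z := by
    ext1 z
    exact fderiv_fun_sub (hφ.differentiable two_ne_zero z) (hψ.differentiable two_ne_zero z)
  unfold hess
  rw [h]
  exact ((hasFDerivAt_fderiv hφ y).fun_sub (hasFDerivAt_fderiv hψ y)).fderiv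

/-- A function that dips inside a square has all small vectors as gradients at interior points
with positive semidefinite second derivative. -/
theorem exists_contact_point {W : E2 → ℝ} (hW : ContDiff ℝ 2 W) {x e : E2} (he : ‖e‖ = 1)
    {l η c : ℝ} (hl : 0 < l) (hη : 2 * l * c ≤ η / 2) (hWx : W x < -η)
    (hbd : ∀ y, |⟪e, y - x⟫| ≤ l → |⟪rot e, y - x⟫| ≤ l →
      (|⟪e, y - x⟫| = l ∨ |⟪rot e, y - x⟫| = l) → 0 ≤ W y) {p : E2} (hp : ‖p‖ ≤ c) :
    ∃ z ∈ closedBall x (2 * l), fderiv ℝ W z = innerSL ℝ p ∧ ∀ v, 0 ≤ hess W z v v := by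
  set Q : Set E2 := {y | |⟪e, y - x⟫| ≤ l ∧ |⟪rot e, y - x⟫| ≤ l} with hQ
  have hce : Continuous fun y => |⟪e, y - x⟫| := by fun_prop
  have hcf : Continuous fun y => |⟪rot e, y - x⟫| := by fun_prop
  have hQb : Q ⊆ closedBall x (2 * l) := by
    rintro y ⟨h1, h2⟩
    rw [mem_closedBall, dist_eq_norm]
    refine abs_le_of_sq_le_sq' ?_ (by positivity) |>.2
    have h := norm_sq_frame he (y - x)
    have := sq_le_sq' (abs_le.1 h1).1 (abs_le.1 h1).2
    have := sq_le_sq' (abs_le.1 h2).1 (abs_le.1 h2).2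
    nlinarith
  have hQc : IsCompact Q := (isCompact_closedBall x (2 * l)).of_isClosed_subset
    ((isClosed_le hce continuous_const).inter (isClosed_le hcf continuous_const)) hQb
  have hxQ : x ∈ Q := by simp [hQ, hl.le]
  set G : E2 → ℝ := fun y => W y - ⟪p, y - x⟫ with hG
  have hin : ContDiff ℝ 2 fun y : E2 => ⟪p, y - x⟫ :=
    contDiff_const.inner ℝ (contDiff_id.sub contDiff_const)
  have hGd : ContDiff ℝ 2 G := hW.sub hin
  obtain ⟨z, hzQ, hz⟩ := hQc.exists_isMinOn ⟨x, hxQ⟩ hGd.continuous.continuousOn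
  have hGz : G z < -η := by
    refine lt_of_le_of_lt (hz hxQ) ?_
    simpa [hG] using hWx
  have hinner : |⟪p, z - x⟫| ≤ η / 2 := by
    refine (abs_real_inner_le_norm _ _).trans ?_
    have := hQb hzQ
    rw [mem_closedBall, dist_eq_norm] at this
    nlinarith [norm_nonneg p, norm_nonneg (z - x), mul_le_mul hp this (norm_nonneg _)
      ((norm_nonneg p).trans hp)]
  have hη0 : 0 ≤ η := by linarith [abs_nonneg ⟪p, z - x⟫]
  have hint : |⟪e, z - x⟫| < l ∧ |⟪rot e, z - x⟫| < l := by
    by_contra hcon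
    have hb : |⟪e, z - x⟫| = l ∨ |⟪rot e, z - x⟫| = l := by
      by_contra! hne
      exact hcon ⟨lt_of_le_of_ne hzQ.1 hne.1, lt_of_le_of_ne hzQ.2 hne.2⟩
    have h0 := hbd z hzQ.1 hzQ.2 hb
    have : G z = W z - ⟪p, z - x⟫ := rfl
    linarith [(abs_le.1 hinner).2]
  have hloc : IsLocalMin G z := by
    have ho : IsOpen {y | |⟪e, y - x⟫| < l ∧ |⟪rot e, y - x⟫| < l} :=
      (isOpen_lt hce continuous_const).inter (isOpen_lt hcf continuous_const)
    filter_upwards [ho.mem_nhds hint] with y hy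
    exact hz ⟨hy.1.le, hy.2.le⟩
  have hfd : ∀ y, fderiv ℝ G y = fderiv ℝ W y - innerSL ℝ p := fun y =>
    ((hW.differentiable two_ne_zero y).hasFDerivAt.sub (hasFDerivAt_inner_sub p x y)).fderiv
  refine ⟨z, hQb hzQ, ?_, ?_⟩
  · have := hloc.fderiv_eq_zero
    rw [hfd, sub_eq_zero] at this
    exact this
  · intro v
    have h := second_fderiv_nonneg_of_isLocalMin hGd hloc v
    have h2 : fderiv ℝ (fderiv ℝ G) z = hess W z := by
      rw [show fderiv ℝ G = fun y => fderiv ℝ W y - innerSL ℝ p from funext hfd, fderiv_sub_const]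
      rfl
    rwa [h2] at h

theorem exists_abp_midpoint {Λ h δ : ℝ} (hΛ : 0 ≤ Λ) (hh : 0 < h) (hδ : 0 < δ) :
    ∃ C > (0 : ℝ), ∃ κ > (0 : ℝ), ∃ m > (0 : ℝ), ∀ φ g : E2 → ℝ, ContDiff ℝ 2 φ →
      Differentiable ℝ g → ∀ x e : E2, ‖e‖ = 1 → ∀ l : ℝ, 0 < l → l ≤ h →
      (∀ y ∈ closedBall x (2 * h), φ y ≤ g y) →
      (∀ y ∈ closedBall x (2 * h), ∀ z ∈ closedBall x (2 * h),
        ‖fderiv ℝ g y - fderiv ℝ g z‖ ≤ Λ * ‖y - z‖) →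
      (∀ y ∈ closedBall x (2 * h), 0 ≤ tr2 (hess φ y)) →
      volume {y ∈ closedBall x (2 * h) | hess φ y e e ≤ -κ ∧ tr2 (hess φ y) ≤ C}
        < ENNReal.ofReal m →
      φ x ≤ (g (x + l • e) + g (x - l • e)) / 2 + δ := by
  set C := Λ ^ 2 * h ^ 2 / δ + 4 * Λ + 1 with hC
  set κ := δ / (4 * h ^ 2) with hκ
  have hC1 : 1 ≤ C := by
    have : 0 ≤ Λ ^ 2 * h ^ 2 / δ := by positivity
    linarith
  have hκ0 : 0 < κ := by positivity
  have hC0 : 0 < C := by linarith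
  set c := δ / (8 * h) with hc
  have hc0 : 0 < c := by positivity
  have hvpos : 0 < volume (ball (0 : E2) c) := measure_ball_pos _ _ hc0
  have hvfin : volume (ball (0 : E2) c) ≠ ⊤ := measure_ball_lt_top.ne
  refine ⟨2 * C, by positivity, 2 * κ, by positivity, (volume (ball (0 : E2) c)).toReal / C ^ 2,
    div_pos (ENNReal.toReal_pos hvpos.ne' hvfin) (by positivity), ?_⟩
  intro φ g hφ hg x e he l hl hlh hle hL htr hvol
  by_contra! hcon
  set A := (g (x + l • e) + g (x - l • e)) / 2 with hA
  set q := quadFn x e (rot e) (A + δ / 4 + κ * l ^ 2) ((g (x + l • e) - g (x - l • e)) / (2 * l))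
    (fderiv ℝ g x (rot e)) C κ with hq
  have hqd : ContDiff ℝ 2 q := contDiff_quadFn ..
  set W : E2 → ℝ := fun y => q y - φ y with hW
  have hWd : ContDiff ℝ 2 W := hqd.sub hφ
  have hhW : ∀ y v w, hess W y v w
      = 2 * C * ⟪rot e, v⟫ * ⟪rot e, w⟫ - 2 * κ * ⟪e, v⟫ * ⟪e, w⟫ - hess φ y v w := by
    intro y v w
    rw [hW, hess_sub hqd hφ, sub_apply, sub_apply, hq, hess_quadFn]
  have hWx : W x < -(δ / 2) := by
    have h1 : q x = A + δ / 4 + κ * l ^ 2 := by simp [hq, quadFn]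
    have h2 : κ * l ^ 2 ≤ δ / 4 := by
      have h3 : κ * h ^ 2 = δ / 4 := by rw [hκ]; field_simp
      nlinarith [mul_le_mul_of_nonneg_left (pow_le_pow_left₀ hl.le hlh 2) hκ0.le]
    simp only [hW, h1]
    linarith
  have hbd : ∀ y, |⟪e, y - x⟫| ≤ l → |⟪rot e, y - x⟫| ≤ l →
      (|⟪e, y - x⟫| = l ∨ |⟪rot e, y - x⟫| = l) → 0 ≤ W y := by
    intro y h1 h2 h3
    have h4 := le_quadFn_of_mem_frontier_square hΛ hδ hg he hl hlh hL h1 h2 h3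
    have h5 : φ y ≤ g y := by
      refine hle y ?_
      rw [mem_closedBall, dist_eq_norm]
      refine abs_le_of_sq_le_sq' ?_ (by positivity) |>.2
      have h := norm_sq_frame he (y - x)
      have := sq_le_sq' (abs_le.1 h1).1 (abs_le.1 h1).2
      have := sq_le_sq' (abs_le.1 h2).1 (abs_le.1 h2).2
      nlinarith
    exact sub_nonneg.2 (h5.trans h4)
  set K : Set E2 := {y ∈ closedBall x (2 * h) | hess φ y e e ≤ -(2 * κ) ∧ tr2 (hess φ y) ≤ 2 * C ∧
    |det2 (hess W y)| ≤ C ^ 2} with hK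
  have hdc : Continuous fun y => |det2 (hess W y)| :=
    (continuous_det2.comp (continuous_hess hWd)).abs
  have hec : Continuous fun y => hess φ y e e :=
    (continuous_bilin_apply e e).comp (continuous_hess hφ)
  have htc : Continuous fun y => tr2 (hess φ y) := continuous_tr2.comp (continuous_hess hφ)
  have hKclosed : IsClosed K :=
    isClosed_closedBall.inter ((isClosed_le hec continuous_const).inter
      ((isClosed_le htc continuous_const).inter (isClosed_le hdc continuous_const)))
  have hsub : ball (0 : E2) c ⊆ (fun y => gradMap (fderiv ℝ W y)) '' K := by
    intro p hp
    rw [mem_ball_zero_iff] at hp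
    obtain ⟨z, hzb, hz1, hz2⟩ := exists_contact_point hWd he hl (η := δ / 2) (c := c)
      (by
        have h3 : h * c = δ / 8 := by rw [hc]; field_simp
        nlinarith) hWx hbd hp.le
    have hzb' : z ∈ closedBall x (2 * h) := closedBall_subset_closedBall (by linarith) hzb
    have htrz := htr z hzb'
    have htrW : tr2 (hess W z) = 2 * C - 2 * κ - tr2 (hess φ z) := by
      have h1 := tr2_inner_mul he (2 * C) (2 * κ) (rot e) (norm_rot he)
        (B := hess W z + hess φ z) (by
          intro v w
          rw [add_apply, add_apply, hhW]; ring)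
      have h2 : tr2 (hess W z + hess φ z) = tr2 (hess W z) + tr2 (hess φ z) := by
        simp only [tr2, add_apply]; ring
      linarith
    have htr0 : 0 ≤ tr2 (hess W z) := add_nonneg (hz2 _) (hz2 _)
    have hdet := det2_bounds hz2 (hess_symm hWd z)
    refine ⟨z, ⟨hzb', ?_, ?_, ?_⟩, ?_⟩
    · have h1 := hz2 e
      rw [hhW, real_inner_comm, inner_rot, real_inner_self_eq_norm_sq, he] at h1
      linarith
    · linarith
    · rw [abs_of_nonneg hdet.1]
      refine hdet.2.trans (pow_le_pow_left₀ (by linarith) (by linarith) 2)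
    · simp only [hz1, gradMap_innerSL]
  have himg := addHaar_image_le_lintegral_abs_det_fderiv volume hKclosed.measurableSet
    (f := fun y => gradMap (fderiv ℝ W y)) (f' := fun y => gradMap ∘L hess W y) (fun y _ =>
      (gradMap.hasFDerivAt.comp y (hasFDerivAt_fderiv hWd y)).hasFDerivWithinAt)
  have hint : ∫⁻ y in K, ENNReal.ofReal |(gradMap ∘L hess W y).det| ≤
      ENNReal.ofReal (C ^ 2) * volume K := by
    rw [← setLIntegral_const]
    refine setLIntegral_mono measurable_const fun y hy => ?_
    rw [det_gradMap_comp]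
    exact ENNReal.ofReal_le_ofReal hy.2.2.2
  have hKle : volume K < ENNReal.ofReal ((volume (ball (0 : E2) c)).toReal / C ^ 2) :=
    by
    refine lt_of_le_of_lt (measure_mono ?_) hvol
    exact fun y hy => ⟨hy.1, hy.2.1, hy.2.2.1⟩
  have hfinal := (measure_mono hsub).trans (himg.trans hint)
  have hlt : ENNReal.ofReal (C ^ 2) * volume K < volume (ball (0 : E2) c) := by
    calc ENNReal.ofReal (C ^ 2) * volume K
        < ENNReal.ofReal (C ^ 2) * ENNReal.ofReal ((volume (ball (0 : E2) c)).toReal / C ^ 2) :=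
          ENNReal.mul_lt_mul_right (by positivity) ENNReal.ofReal_ne_top hKle
      _ = volume (ball (0 : E2) c) := by
          rw [← ENNReal.ofReal_mul (by positivity), mul_div_cancel₀ _ (by positivity),
            ENNReal.ofReal_toReal hvfin]
  exact absurd hfinal (not_le.2 hlt)

/-- The linear form on the plane with given coordinates. -/
def covec (a b : ℝ) : E2 →L[ℝ] ℝ := a • innerSL ℝ (b2 0) + b • innerSL ℝ (b2 1)

theorem covec_apply (a b : ℝ) (v : E2) : covec a b v = a * v 0 + b * v 1 := by
  simp [covec, b2, EuclideanSpace.inner_single_left]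

theorem hasFDerivAt_covec {a b : E2 → ℝ} {a' b' : E2 →L[ℝ] ℝ} {y : E2} (ha : HasFDerivAt a a' y)
    (hb : HasFDerivAt b b' y) :
    HasFDerivAt (fun z => covec (a z) (b z))
      (a'.smulRight (innerSL ℝ (b2 0)) + b'.smulRight (innerSL ℝ (b2 1))) y :=
  (ha.smul_const (innerSL ℝ (b2 0))).fun_add (hb.smul_const (innerSL ℝ (b2 1)))

theorem b2_zero_zero : b2 0 0 = 1 := by simp [b2]
theorem b2_zero_one : b2 0 1 = 0 := by simp [b2]
theorem b2_one_zero : b2 1 0 = 0 := by simp [b2]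
theorem b2_one_one : b2 1 1 = 1 := by simp [b2]

/-- A closed differential form on a disk is exact. -/
theorem exists_hasFDerivAt_covec {x : E2} {r : ℝ} {a b : E2 → ℝ}
    (ha : ∀ y ∈ ball x r, DifferentiableAt ℝ a y) (hb : ∀ y ∈ ball x r, DifferentiableAt ℝ b y)
    (hab : ∀ y ∈ ball x r, fderiv ℝ a y (b2 1) = fderiv ℝ b y (b2 0)) :
    ∃ f : E2 → ℝ, ∀ y ∈ ball x r, HasFDerivAt f (covec (a y) (b y)) y := by
  refine (convex_ball x r).exists_forall_hasFDerivAt_of_fderiv_symmetric isOpen_ball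
    (ω := fun y => covec (a y) (b y)) ?_ ?_
  · intro y hy
    exact (hasFDerivAt_covec (ha y hy).hasFDerivAt
      (hb y hy).hasFDerivAt).differentiableAt.differentiableWithinAt
  · intro y hy v w
    rw [(hasFDerivAt_covec (ha y hy).hasFDerivAt (hb y hy).hasFDerivAt).fderiv]
    have h1 : ∀ (L : E2 →L[ℝ] ℝ) v, L v = v 0 * L (b2 0) + v 1 * L (b2 1) := by
      intro L v
      conv_lhs => rw [E2_eq_sum v]
      simp
    have h := hab y hy
    simp only [add_apply, ContinuousLinearMap.smulRight_apply, smul_apply, innerSL_apply_apply,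
      inner_E2, b2_zero_zero, b2_zero_one, b2_one_zero, b2_one_one, smul_eq_mul]
    rw [h1 (fderiv ℝ a y) v, h1 (fderiv ℝ a y) w, h1 (fderiv ℝ b y) v, h1 (fderiv ℝ b y) w]
    linear_combination (w 0 * v 1 - v 0 * w 1) * h

theorem contDiffOn_one_of_hasFDerivAt {s : Set E2} (hs : IsOpen s) {f : E2 → ℝ}
    {f' : E2 → E2 →L[ℝ] ℝ} {n : ℕ} (hf : ∀ y ∈ s, HasFDerivAt f (f' y) y)
    (hf' : ContDiffOn ℝ n f' s) :
    ContDiffOn ℝ (n + 1 : ℕ) f s := by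
  have : ContDiffOn ℝ ((n : WithTop ℕ∞) + 1) f s := by
    rw [contDiffOn_succ_iff_fderiv_of_isOpen hs]
    refine ⟨fun y hy => (hf y hy).differentiableAt.differentiableWithinAt, by simp, ?_⟩
    exact hf'.congr fun y hy => (hf y hy).fderiv
  simpa using this

theorem contDiffOn_covec {s : Set E2} {a b : E2 → ℝ} {n : WithTop ℕ∞} (ha : ContDiffOn ℝ n a s)
    (hb : ContDiffOn ℝ n b s) : ContDiffOn ℝ n (fun y => covec (a y) (b y)) s :=
  (ha.smul contDiffOn_const).add (hb.smul contDiffOn_const)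

/-- A symmetric divergence free matrix field on a disk is, up to rotation, the second derivative
of a function. -/
theorem exists_hess_eq {x : E2} {r : ℝ} {a b d : E2 → ℝ}
    (ha : ∀ y ∈ ball x r, DifferentiableAt ℝ a y) (hb : ∀ y ∈ ball x r, DifferentiableAt ℝ b y)
    (hd : ∀ y ∈ ball x r, DifferentiableAt ℝ d y)
    (hab : ∀ y ∈ ball x r, fderiv ℝ a y (b2 1) = fderiv ℝ b y (b2 0))
    (hbd : ∀ y ∈ ball x r, fderiv ℝ b y (b2 1) = fderiv ℝ d y (b2 0)) :
    ∃ φ : E2 → ℝ, ContDiffOn ℝ 2 φ (ball x r) ∧ ∀ y ∈ ball x r, ∀ v w,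
      hess φ y v w = (a y * v 0 + b y * v 1) * w 0 + (b y * v 0 + d y * v 1) * w 1 := by
  obtain ⟨p, hp⟩ := exists_hasFDerivAt_covec ha hb hab
  obtain ⟨q, hq⟩ := exists_hasFDerivAt_covec hb hd hbd
  obtain ⟨φ, hφ⟩ := exists_hasFDerivAt_covec (a := p) (b := q)
    (fun y hy => (hp y hy).differentiableAt) (fun y hy => (hq y hy).differentiableAt) (by
      intro y hy
      rw [(hp y hy).fderiv, (hq y hy).fderiv, covec_apply, covec_apply, b2_zero_zero, b2_zero_one,
        b2_one_zero, b2_one_one]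
      ring)
  have hc : ∀ {a : E2 → ℝ}, (∀ y ∈ ball x r, DifferentiableAt ℝ a y) →
      ContDiffOn ℝ (0 : ℕ) a (ball x r) := fun h =>
    contDiffOn_zero.2 fun y hy => (h y hy).continuousAt.continuousWithinAt
  have hp1 := contDiffOn_one_of_hasFDerivAt isOpen_ball hp (contDiffOn_covec (hc ha) (hc hb))
  have hq1 := contDiffOn_one_of_hasFDerivAt isOpen_ball hq (contDiffOn_covec (hc hb) (hc hd))
  refine ⟨φ, contDiffOn_one_of_hasFDerivAt isOpen_ball hφ (contDiffOn_covec hp1 hq1), ?_⟩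
  intro y hy v w
  have h1 : fderiv ℝ φ =ᶠ[𝓝 y] fun z => covec (p z) (q z) := by
    filter_upwards [isOpen_ball.mem_nhds hy] with z hz
    exact (hφ z hz).fderiv
  unfold hess
  rw [h1.fderiv_eq, (hasFDerivAt_covec (hp y hy) (hq y hy)).fderiv]
  simp [covec_apply, inner_E2, b2_zero_zero, b2_zero_one, b2_one_zero, b2_one_one]

theorem exists_contDiff_eqOn_ball {x : E2} {r₁ r : ℝ} (h0 : 0 < r₁) (hr : r₁ < r) {φ : E2 → ℝ}
    (hφ : ContDiffOn ℝ 2 φ (ball x r)) :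
    ∃ ψ : E2 → ℝ, ContDiff ℝ 2 ψ ∧ HasCompactSupport ψ ∧ ∀ y ∈ ball x r₁, ψ y = φ y := by
  let χ : ContDiffBump x := ⟨r₁, (r₁ + r) / 2, h0, by linarith⟩
  refine ⟨fun y => χ y * φ y, ?_, χ.hasCompactSupport.mul_right, ?_⟩
  · rw [contDiff_iff_contDiffAt]
    intro y
    by_cases hy : y ∈ ball x r
    · exact χ.contDiff.contDiffAt.mul (hφ.contDiffAt (isOpen_ball.mem_nhds hy))
    · have hy' : y ∉ tsupport χ := by
        rw [χ.tsupport_eq]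
        intro h
        exact hy (closedBall_subset_ball (by change (r₁ + r) / 2 < r; linarith) h)
      have h1 : (fun y => χ y * φ y) =ᶠ[𝓝 y] fun _ => 0 := by
        filter_upwards [(isClosed_tsupport χ).isOpen_compl.mem_nhds hy'] with z hz
        rw [image_eq_zero_of_notMem_tsupport hz, zero_mul]
      exact contDiffAt_const.congr_of_eventuallyEq h1
  · intro y hy
    change χ y * φ y = φ y
    rw [χ.one_of_mem_closedBall (ball_subset_closedBall hy), one_mul]

theorem contDiffOn_pder {k : ℕ} {u : E2 → Evec k} {Ω : Set E2} (hΩ : IsOpen Ω)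
    (hu : ContDiffOn ℝ (⊤ : ℕ∞) u Ω) (i : Fin 2) : ContDiffOn ℝ (⊤ : ℕ∞) (pder u i) Ω :=
  (hu.fderiv_of_isOpen hΩ (m := (⊤ : ℕ∞)) (by simp)).clm_apply contDiffOn_const

theorem hasFDerivAt_pder {k : ℕ} {u : E2 → Evec k} {Ω : Set E2} (hΩ : IsOpen Ω)
    (hu : ContDiffOn ℝ (⊤ : ℕ∞) u Ω) (i : Fin 2) {y : E2} (hy : y ∈ Ω) :
    HasFDerivAt (pder u i) (fderiv ℝ (pder u i) y) y :=
  (((contDiffOn_pder hΩ hu i).contDiffAt (hΩ.mem_nhds hy)).differentiableAt (by simp)).hasFDerivAt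

theorem fderiv_pder_comm {k : ℕ} {u : E2 → Evec k} {Ω : Set E2} (hΩ : IsOpen Ω)
    (hu : ContDiffOn ℝ (⊤ : ℕ∞) u Ω) (i j : Fin 2) {y : E2} (hy : y ∈ Ω) :
    fderiv ℝ (pder u i) y (b2 j) = fderiv ℝ (pder u j) y (b2 i) := by
  have hc := hu.contDiffAt (hΩ.mem_nhds hy)
  have hs : IsSymmSndFDerivAt ℝ u y := hc.isSymmSndFDerivAt
    (by rw [minSmoothness_of_isRCLikeNormedField]; exact WithTop.coe_le_coe.2 (le_top : (2 : ℕ∞) ≤ ⊤))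
  have hd : DifferentiableAt ℝ (fderiv ℝ u) y :=
    (hc.fderiv_right (m := (⊤ : ℕ∞)) (by simp)).differentiableAt (by simp)
  have h : ∀ i, fderiv ℝ (pder u i) y = (fderiv ℝ (fderiv ℝ u) y).flip (b2 i) := by
    intro i
    exact (hd.hasFDerivAt.clm_apply (hasFDerivAt_const (b2 i) y)).fderiv.trans (by ext; simp)
  rw [h, h]
  exact hs (b2 j) (b2 i)

theorem hasFDerivAt_comp_potential {k : ℕ} {V : Evec k → ℝ} (hV : ContDiff ℝ (⊤ : ℕ∞) V)
    {u : E2 → Evec k} {Ω : Set E2} (hΩ : IsOpen Ω) (hu : ContDiffOn ℝ (⊤ : ℕ∞) u Ω) {y : E2}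
    (hy : y ∈ Ω) : HasFDerivAt (fun z => V (u z)) (fderiv ℝ V (u y) ∘L fderiv ℝ u y) y :=
  (hV.differentiable (by simp) (u y)).hasFDerivAt.comp y
    ((hu.contDiffAt (hΩ.mem_nhds hy)).differentiableAt (by simp)).hasFDerivAt

theorem fderiv_potential_apply {k : ℕ} {V : Evec k → ℝ} {ε : ℝ} (hε : 0 < ε)
    {u : E2 → Evec k} {Ω : Set E2} (hu : IsSolution V ε Ω u) {y : E2} (hy : y ∈ Ω) (w : Evec k) :
    fderiv ℝ V (u y) w
      = ε ^ 2 * ⟪fderiv ℝ (pder u 0) y (b2 0) + fderiv ℝ (pder u 1) y (b2 1), w⟫ := by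
  have h := hu.2 y hy
  rw [lap, Fin.sum_univ_two] at h
  have h1 : ⟪gradient V (u y), w⟫ = fderiv ℝ V (u y) w := by
    rw [gradient, InnerProductSpace.toDual_symm_apply]
  rw [h, inner_smul_left, h1]
  simp
  field_simp

/-- The second derivative of `exists_stress_potential` is the rotated stress tensor of a solution,
which is divergence free. -/
theorem exists_stress_potential {k : ℕ} {V : Evec k → ℝ} (hV : ContDiff ℝ (⊤ : ℕ∞) V)
    (hV0 : ∀ y, 0 ≤ V y) {ε : ℝ} (hε : 0 < ε) {u : E2 → Evec k} {Ω : Set E2} (hΩ : IsOpen Ω)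
    (hu : IsSolution V ε Ω u) {x : E2} {r₁ r : ℝ} (h0 : 0 < r₁) (hr : r₁ < r)
    (hrΩ : ball x r ⊆ Ω) :
    ∃ φ : E2 → ℝ, ContDiff ℝ 2 φ ∧ HasCompactSupport φ ∧ ∀ y ∈ ball x r₁,
      (∀ e : E2, ‖e‖ = 1 → ε⁻¹ * V (u y) - ε / 2 * gradSq u y ≤ hess φ y e e) ∧
      tr2 (hess φ y) = 2 * (ε⁻¹ * V (u y)) ∧ ‖hess φ y‖ ≤ 4 * eDens V ε u y := by
  have hus := hu.1
  have hN : ∀ y ∈ ball x r, ∀ i, HasFDerivAt (fun z => ‖pder u i z‖ ^ 2)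
      (2 • (innerSL ℝ (pder u i y)).comp (fderiv ℝ (pder u i) y)) y := fun y hy i =>
    (hasFDerivAt_pder hΩ hus i (hrΩ hy)).norm_sq
  have hI : ∀ y ∈ ball x r, HasFDerivAt (fun z => ⟪pder u 0 z, pder u 1 z⟫) _ y := fun y hy =>
    (hasFDerivAt_pder hΩ hus 0 (hrΩ hy)).inner ℝ (hasFDerivAt_pder hΩ hus 1 (hrΩ hy))
  have hW := fun y (hy : y ∈ ball x r) => hasFDerivAt_comp_potential hV hΩ hus (hrΩ hy)
  have ha := fun y hy => ((((hN y hy 0).fun_sub (hN y hy 1)).const_mul (ε / 2)).fun_add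
    ((hW y hy).const_mul ε⁻¹))
  have hb := fun y hy => (hI y hy).const_mul ε
  have hd := fun y hy => ((((hN y hy 1).fun_sub (hN y hy 0)).const_mul (ε / 2)).fun_add
    ((hW y hy).const_mul ε⁻¹))
  obtain ⟨φ₀, hφ₀, hh⟩ := exists_hess_eq (fun y hy => (ha y hy).differentiableAt)
    (fun y hy => (hb y hy).differentiableAt) (fun y hy => (hd y hy).differentiableAt)
    (by
      intro y hy
      rw [(ha y hy).fderiv, (hb y hy).fderiv]
      have hc := fderiv_pder_comm hΩ hus 0 1 (hrΩ hy)
      have hp : ∀ i, fderiv ℝ u y (b2 i) = pder u i y := fun _ => rfl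
      simp [hp, fderiv_potential_apply hε hu (hrΩ hy), hc, inner_add_right,
        real_inner_comm (pder u 1 y)]
      field_simp
      ring)
    (by
      intro y hy
      rw [(hb y hy).fderiv, (hd y hy).fderiv]
      have hc := fderiv_pder_comm hΩ hus 0 1 (hrΩ hy)
      have hp : ∀ i, fderiv ℝ u y (b2 i) = pder u i y := fun _ => rfl
      simp [hp, fderiv_potential_apply hε hu (hrΩ hy), hc, inner_add_right,
        real_inner_comm (pder u 0 y), real_inner_comm (pder u 1 y)]
      field_simp
      ring)
  obtain ⟨φ, hφ, hφc, hφe⟩ := exists_contDiff_eqOn_ball h0 hr hφ₀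
  refine ⟨φ, hφ, hφc, fun y hy => ?_⟩
  have hheq : hess φ y = hess φ₀ y := by
    have : φ =ᶠ[𝓝 y] φ₀ := by
      filter_upwards [isOpen_ball.mem_nhds hy] with z hz using hφe z hz
    exact this.fderiv.fderiv_eq
  have hyr : y ∈ ball x r := ball_subset_ball hr.le hy
  have hform := hh y hyr
  rw [← hheq] at hform
  have hg : gradSq u y = ‖pder u 0 y‖ ^ 2 + ‖pder u 1 y‖ ^ 2 := by
    rw [gradSq, Fin.sum_univ_two]
  have hvpos : 0 ≤ ε⁻¹ * V (u y) := mul_nonneg (inv_nonneg.2 hε.le) (hV0 _)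
  refine ⟨fun e he => ?_, ?_, ?_⟩
  · have he2 : e 0 ^ 2 + e 1 ^ 2 = 1 := by rw [← norm_sq_E2, he]; norm_num
    have hsq : 0 ≤ ε * ‖e 0 • pder u 0 y + e 1 • pder u 1 y‖ ^ 2 := by positivity
    rw [norm_add_sq_real, norm_smul, norm_smul, real_inner_smul_left, real_inner_smul_right,
      mul_pow, mul_pow, Real.norm_eq_abs, Real.norm_eq_abs, sq_abs, sq_abs] at hsq
    rw [hform, hg]
    generalize ‖pder u 0 y‖ ^ 2 = A at *
    generalize ‖pder u 1 y‖ ^ 2 = B at *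
    generalize ε⁻¹ * V (u y) = v at *
    linear_combination hsq + (ε / 2 * (A + B) - v) * he2
  · simp only [tr2, hform, b2_zero_zero, b2_zero_one, b2_one_zero, b2_one_one]
    ring
  · have hE : eDens V ε u y = ε / 2 * (‖pder u 0 y‖ ^ 2 + ‖pder u 1 y‖ ^ 2) + ε⁻¹ * V (u y) := by
      rw [eDens, hg]
    have hin := abs_real_inner_le_norm (pder u 0 y) (pder u 1 y)
    generalize hAe : ‖pder u 0 y‖ = A at *
    generalize hBe : ‖pder u 1 y‖ = B at *
    generalize ε⁻¹ * V (u y) = v at *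
    generalize ⟪pder u 0 y, pder u 1 y⟫ = I at *
    have hA2 : 0 ≤ ε / 2 * A ^ 2 := by positivity
    have hB2 : 0 ≤ ε / 2 * B ^ 2 := by positivity
    have e1 : |ε / 2 * (A ^ 2 - B ^ 2) + v| ≤ eDens V ε u y := by
      rw [hE, abs_le]; constructor <;> linarith
    have e3 : |ε / 2 * (B ^ 2 - A ^ 2) + v| ≤ eDens V ε u y := by
      rw [hE, abs_le]; constructor <;> linarith
    have e2 : |ε * I| ≤ eDens V ε u y := by
      rw [hE, abs_mul, abs_of_pos hε]
      nlinarith [mul_le_mul_of_nonneg_left hin hε.le, mul_nonneg hε.le (sq_nonneg (A - B))]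
    have hE0 : 0 ≤ eDens V ε u y := (abs_nonneg _).trans e1
    have hcoord : ∀ (v : E2) i, |v i| ≤ ‖v‖ := fun v i => PiLp.norm_apply_le v i
    refine ContinuousLinearMap.opNorm_le_bound₂ _ (by positivity) fun v w => ?_
    rw [hform, Real.norm_eq_abs]
    generalize eDens V ε u y = E at *
    have hb : ∀ a b : ℝ, |a| ≤ E → |b| ≤ E → |a * v 0 + b * v 1| ≤ 2 * E * ‖v‖ := by
      intro a b ha hb
      refine (abs_add_le _ _).trans ?_
      rw [abs_mul, abs_mul]
      have := mul_le_mul ha (hcoord v 0) (abs_nonneg _) hE0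
      have := mul_le_mul hb (hcoord v 1) (abs_nonneg _) hE0
      linarith
    refine (abs_add_le _ _).trans ?_
    rw [abs_mul, abs_mul]
    have f1 := mul_le_mul (hb _ _ e1 e2) (hcoord w 0) (abs_nonneg _) (by positivity)
    have f2 := mul_le_mul (hb _ _ e2 e3) (hcoord w 1) (abs_nonneg _) (by positivity)
    linarith

theorem exists_abs_deriv_smoothTransition_le :
    ∃ M > (0 : ℝ), ∀ t : ℝ, |deriv Real.smoothTransition t| ≤ M := by
  have hc : Continuous (deriv Real.smoothTransition) :=
    (Real.smoothTransition.contDiff (n := 1)).continuous_deriv le_rfl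
  obtain ⟨M, hM⟩ := (isCompact_Icc (a := (0 : ℝ)) (b := 1)).exists_bound_of_continuousOn
    hc.continuousOn
  refine ⟨|M| + 1, by positivity, fun t => ?_⟩
  by_cases ht : t ∈ Set.Icc (0 : ℝ) 1
  · exact (hM t ht).trans (by linarith [le_abs_self M])
  · have h0 : deriv Real.smoothTransition t = 0 := by
      rw [Set.mem_Icc, not_and_or, not_le, not_le] at ht
      rcases ht with ht | ht
      · have : Real.smoothTransition =ᶠ[𝓝 t] fun _ => 0 := by
          filter_upwards [Iio_mem_nhds ht] with y hy
          exact Real.smoothTransition.zero_of_nonpos (le_of_lt hy)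
        rw [this.deriv_eq, deriv_const]
      · have : Real.smoothTransition =ᶠ[𝓝 t] fun _ => 1 := by
          filter_upwards [Ioi_mem_nhds ht] with y hy
          exact Real.smoothTransition.one_of_one_le (le_of_lt hy)
        rw [this.deriv_eq, deriv_const]
    rw [h0, abs_zero]
    positivity

/-- A logarithmic cutoff: its derivative is small relative to the reciprocal of the argument. -/
theorem exists_log_cutoff {κ δ : ℝ} (hκ : 0 < κ) (hδ : 0 < δ) :
    ∃ s > (0 : ℝ), ∃ P : ℝ → ℝ, ContDiff ℝ (⊤ : ℕ∞) P ∧ (∀ t, 0 ≤ P t) ∧ (∀ t, P t ≤ 1) ∧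
      (∀ t, 0 ≤ t → t ≤ s → P t = 1) ∧ (∀ t, δ ≤ t → P t = 0) ∧ ∀ t, |t * deriv P t| ≤ κ := by
  obtain ⟨M, hM0, hM⟩ := exists_abs_deriv_smoothTransition_le
  set c := κ / (2 * M) with hc
  have hc0 : 0 < c := by positivity
  set s := δ * Real.exp (-(1 / (2 * c))) / 2 with hs
  have hs0 : 0 < s := by positivity
  have hpos : ∀ t : ℝ, 0 < t ^ 2 + s ^ 2 := fun t => by positivity
  set L : ℝ → ℝ := fun t => c * (Real.log (δ ^ 2) - Real.log (t ^ 2 + s ^ 2)) with hL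
  have hLd : ContDiff ℝ (⊤ : ℕ∞) L := by
    refine contDiff_const.mul (contDiff_const.sub (ContDiff.log ?_ fun t => (hpos t).ne'))
    exact (contDiff_id.pow 2).add contDiff_const
  have hLder : ∀ t, HasDerivAt L (c * -(2 * t / (t ^ 2 + s ^ 2))) t := by
    intro t
    have h1 : HasDerivAt (fun t : ℝ => t ^ 2 + s ^ 2) (2 * t) t := by
      simpa using (hasDerivAt_pow 2 t).add_const (s ^ 2)
    exact ((h1.log (hpos t).ne').const_sub _).const_mul c
  refine ⟨s, hs0, fun t => Real.smoothTransition (L t), Real.smoothTransition.contDiff.comp hLd,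
    fun t => Real.smoothTransition.nonneg _, fun t => Real.smoothTransition.le_one _, ?_, ?_, ?_⟩
  · intro t ht0 ht
    refine Real.smoothTransition.one_of_one_le ?_
    have h1 : t ^ 2 + s ^ 2 ≤ δ ^ 2 * Real.exp (-(1 / c)) := by
      have : δ ^ 2 * Real.exp (-(1 / c)) = (2 * s) ^ 2 := by
        rw [hs, mul_div_cancel₀ _ two_ne_zero, mul_pow, ← Real.exp_nat_mul]
        congr 2
        push_cast
        field_simp
      rw [this]
      nlinarith
    have h2 := Real.log_le_log (hpos t) h1
    rw [Real.log_mul (by positivity) (by positivity), Real.log_exp] at h2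
    have h3 : 1 / c ≤ Real.log (δ ^ 2) - Real.log (t ^ 2 + s ^ 2) := by linarith
    calc (1 : ℝ) = c * (1 / c) := by field_simp
      _ ≤ L t := mul_le_mul_of_nonneg_left h3 hc0.le
  · intro t ht
    refine Real.smoothTransition.zero_of_nonpos ?_
    have h1 : Real.log (δ ^ 2) ≤ Real.log (t ^ 2 + s ^ 2) :=
      Real.log_le_log (by positivity) (by nlinarith)
    exact mul_nonpos_of_nonneg_of_nonpos hc0.le (by linarith)
  · intro t
    have h1 : HasDerivAt (fun t => Real.smoothTransition (L t))
        (deriv Real.smoothTransition (L t) * (c * -(2 * t / (t ^ 2 + s ^ 2)))) t :=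
      (((Real.smoothTransition.contDiff (n := 1)).differentiable one_ne_zero) _).hasDerivAt.comp t
        (hLder t)
    rw [h1.deriv]
    have h2 : t * (deriv Real.smoothTransition (L t) * (c * -(2 * t / (t ^ 2 + s ^ 2))))
        = -(deriv Real.smoothTransition (L t) * (2 * c * (t ^ 2 / (t ^ 2 + s ^ 2)))) := by ring
    have h3 : t ^ 2 / (t ^ 2 + s ^ 2) ≤ 1 := by
      rw [div_le_one (hpos t)]; nlinarith
    have h4 : 0 ≤ t ^ 2 / (t ^ 2 + s ^ 2) := div_nonneg (sq_nonneg _) (hpos t).le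
    rw [h2, abs_neg, abs_mul, abs_of_nonneg (show 0 ≤ 2 * c * (t ^ 2 / (t ^ 2 + s ^ 2)) by positivity)]
    calc _ ≤ M * (2 * c * 1) := by gcongr; exact hM _
      _ = κ := by rw [hc]; field_simp

theorem exists_fderiv_sub_nonneg {k : ℕ} {V : Evec k → ℝ} (hV : IsMultiWell V) {σ : Evec k}
    (hσ : V σ = 0) :
    ∃ δ > (0 : ℝ), ∀ y, ‖y - σ‖ ^ 2 ≤ δ → 0 ≤ fderiv ℝ V y (y - σ) := by
  have hmin : IsLocalMin V σ := Eventually.of_forall fun y => by rw [hσ]; exact hV.nonneg y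
  have hgrad := hmin.fderiv_eq_zero
  have hd : HasFDerivAt (fderiv ℝ V) (fderiv ℝ (fderiv ℝ V) σ) σ :=
    ((hV.smooth.fderiv_right (m := 1) (by exact WithTop.coe_le_coe.2 le_top)).differentiable
      one_ne_zero σ).hasFDerivAt
  set H := fderiv ℝ (fderiv ℝ V) σ with hH
  have hpos : ∀ w, w ≠ 0 → 0 < H w w := by
    intro w hw
    have := hV.hess_posdef σ hσ w hw
    rwa [iteratedFDeriv_two_apply] at this
  obtain ⟨c, hc, hcH⟩ : ∃ c > (0 : ℝ), ∀ w, c * ‖w‖ ^ 2 ≤ H w w := by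
    rcases (sphere (0 : Evec k) 1).eq_empty_or_nonempty with he | hne
    · refine ⟨1, one_pos, fun w => ?_⟩
      have hw : w = 0 := by
        by_contra hw
        have : ‖w‖⁻¹ • w ∈ sphere (0 : Evec k) 1 := by
          simp [norm_smul, norm_ne_zero_iff.2 hw]
        rw [he] at this
        exact this
      simp [hw]
    · have hcont : Continuous fun w => H w w := H.continuous.clm_apply continuous_id
      obtain ⟨w₀, hw₀, hm⟩ := (isCompact_sphere (0 : Evec k) 1).exists_isMinOn hne
        hcont.continuousOn
      have hw₀0 : w₀ ≠ 0 := by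
        rintro rfl
        simp at hw₀
      refine ⟨H w₀ w₀, hpos _ hw₀0, fun w => ?_⟩
      rcases eq_or_ne w 0 with rfl | hw
      · simp
      · have hn := norm_ne_zero_iff.2 hw
        have h1 : H w₀ w₀ ≤ H (‖w‖⁻¹ • w) (‖w‖⁻¹ • w) := hm (by simp [norm_smul, hn])
        simp only [map_smul, smul_apply, smul_eq_mul] at h1
        calc H w₀ w₀ * ‖w‖ ^ 2 ≤ (‖w‖⁻¹ * (‖w‖⁻¹ * H w w)) * ‖w‖ ^ 2 := by gcongr
          _ = H w w := by field_simp
  have ho := (hasFDerivAt_iff_isLittleO.1 hd).bound hc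
  obtain ⟨r, hr, hball⟩ := Metric.eventually_nhds_iff.1 ho
  refine ⟨(r / 2) ^ 2, by positivity, fun y hy => ?_⟩
  have hyr : ‖y - σ‖ ≤ r / 2 := (abs_le_of_sq_le_sq' hy (by positivity)).2
  have h1 := hball (show dist y σ < r by rw [dist_eq_norm]; linarith)
  rw [hgrad, sub_zero] at h1
  have h2 := (fderiv ℝ V y - H (y - σ)).le_opNorm (y - σ)
  rw [sub_apply, Real.norm_eq_abs] at h2
  have h3 := mul_le_mul_of_nonneg_right h1 (norm_nonneg (y - σ))
  have h4 := (abs_le.1 (h2.trans h3)).1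
  have h5 := hcH (y - σ)
  nlinarith

theorem exists_near_zero_of_potential_le {k : ℕ} {V : Evec k → ℝ} (hV : IsMultiWell V) {s : ℝ}
    (hs : 0 < s) :
    ∃ τ > (0 : ℝ), ∀ y, V y ≤ τ → ∃ σ, V σ = 0 ∧ ‖y - σ‖ ^ 2 ≤ s := by
  obtain ⟨R, hR⟩ := hV.coercive 1
  set K : Set (Evec k) := closedBall 0 R ∩ ⋂ σ ∈ {y | V y = 0}, {y | s ≤ ‖y - σ‖ ^ 2} with hK
  have hKc : IsCompact K := by
    refine (isCompact_closedBall _ _).inter_right (isClosed_biInter fun σ _ => ?_)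
    exact isClosed_le continuous_const (by fun_prop)
  have hnear : ∀ y, y ∉ K → ‖y‖ ≤ R → ∃ σ, V σ = 0 ∧ ‖y - σ‖ ^ 2 ≤ s := by
    intro y hy hyR
    by_contra! hcon
    refine hy ⟨by simpa using hyR, ?_⟩
    simp only [Set.mem_iInter]
    exact fun σ hσ => (hcon σ hσ).le
  rcases K.eq_empty_or_nonempty with he | hne
  · refine ⟨1 / 2, by norm_num, fun y hy => hnear y (by simp [he]) ?_⟩
    by_contra! h
    linarith [hR y h.le]
  · obtain ⟨z, hz, hm⟩ := hKc.exists_isMinOn hne hV.smooth.continuous.continuousOn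
    have hVz : 0 < V z := by
      refine lt_of_le_of_ne (hV.nonneg z) fun h => ?_
      have := Set.mem_iInter₂.1 hz.2 z h.symm
      simp at this
      linarith
    refine ⟨min (1 / 2) (V z / 2), by positivity, fun y hy => hnear y ?_ ?_⟩
    · intro hyK
      have : V z ≤ V y := hm hyK
      linarith [min_le_right (1 / 2) (V z / 2)]
    · by_contra! h
      linarith [hR y h.le, min_le_left (1 / 2) (V z / 2)]

theorem contDiff_mul_of_tsupport_subset {n : WithTop ℕ∞} {Ω : Set E2} (hΩ : IsOpen Ω)
    {χ G : E2 → ℝ} (hχ : ContDiff ℝ n χ) (hG : ContDiffOn ℝ n G Ω) (hsub : tsupport χ ⊆ Ω) :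
    ContDiff ℝ n fun y => χ y * G y := by
  rw [contDiff_iff_contDiffAt]
  intro y
  by_cases hy : y ∈ tsupport χ
  · exact hχ.contDiffAt.mul (hG.contDiffAt (hΩ.mem_nhds (hsub hy)))
  · have h1 : (fun y => χ y * G y) =ᶠ[𝓝 y] fun _ => 0 := by
      filter_upwards [(isClosed_tsupport χ).isOpen_compl.mem_nhds hy] with z hz
      rw [image_eq_zero_of_notMem_tsupport hz, zero_mul]
    exact contDiffAt_const.congr_of_eventuallyEq h1

theorem continuous_mul_of_tsupport_subset {Ω : Set E2} (hΩ : IsOpen Ω)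
    {χ G : E2 → ℝ} (hχ : Continuous χ) (hG : ContinuousOn G Ω) (hsub : tsupport χ ⊆ Ω) :
    Continuous fun y => χ y * G y :=
  (contDiff_mul_of_tsupport_subset hΩ (contDiff_zero.2 hχ) (contDiffOn_zero.2 hG) hsub).continuous

theorem continuous_fderiv_apply {f : E2 → ℝ} (hf : ContDiff ℝ 1 f) (v : E2) :
    Continuous fun y => fderiv ℝ f y v :=
  (hf.continuous_fderiv one_ne_zero).clm_apply continuous_const

/-- Integration by parts against a cutoff supported in the open set where the other factor is
differentiable. -/
theorem integral_cutoff_mul_fderiv {Ω : Set E2} (hΩ : IsOpen Ω) {χ G : E2 → ℝ}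
    (hχ : ContDiff ℝ 1 χ) (hχc : HasCompactSupport χ) (hG : ContDiffOn ℝ 1 G Ω)
    (hsub : tsupport χ ⊆ Ω) (v : E2) :
    Integrable (fun y => χ y * fderiv ℝ G y v) ∧ Integrable (fun y => fderiv ℝ χ y v * G y) ∧
    ∫ y, χ y * fderiv ℝ G y v = - ∫ y, fderiv ℝ χ y v * G y := by
  have hG' : ContinuousOn (fun y => fderiv ℝ G y v) Ω :=
    (hG.continuousOn_fderiv_of_isOpen hΩ le_rfl).clm_apply continuousOn_const
  have hsub' : tsupport (fun y => fderiv ℝ χ y v) ⊆ Ω :=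
    (closure_mono (Function.support_subset_iff'.2 fun y hy => by
      have : fderiv ℝ χ y = 0 := by simpa using hy
      simp [this] : Function.support (fun y => fderiv ℝ χ y v)
        ⊆ Function.support (fderiv ℝ χ))).trans ((tsupport_fderiv_subset ℝ).trans hsub)
  have i1 : Integrable (fun y => χ y * fderiv ℝ G y v) :=
    (continuous_mul_of_tsupport_subset hΩ hχ.continuous hG' hsub).integrable_of_hasCompactSupport
      hχc.mul_right
  have i2 : Integrable (fun y => fderiv ℝ χ y v * G y) :=
    (continuous_mul_of_tsupport_subset hΩ (continuous_fderiv_apply hχ v) hG.continuousOn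
      hsub').integrable_of_hasCompactSupport (hχc.fderiv_apply ℝ v).mul_right
  have i3 : Integrable (fun y => χ y * G y) :=
    (continuous_mul_of_tsupport_subset hΩ hχ.continuous hG.continuousOn
      hsub).integrable_of_hasCompactSupport hχc.mul_right
  exact ⟨i1, i2, integral_mul_fderiv_eq_neg_fderiv_mul_of_integrable i2 i1 i3
    (fun y _ => hχ.differentiable one_ne_zero y) fun y hy =>
      (hG.contDiffAt (hΩ.mem_nhds (hsub hy))).differentiableAt one_ne_zero⟩

theorem gradSq_eq {k : ℕ} (u : E2 → Evec k) (y : E2) :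
    gradSq u y = ‖pder u 0 y‖ ^ 2 + ‖pder u 1 y‖ ^ 2 := by
  rw [gradSq, Fin.sum_univ_two]

theorem gradSq_nonneg {k : ℕ} (u : E2 → Evec k) (y : E2) : 0 ≤ gradSq u y := by
  rw [gradSq_eq]; positivity

theorem eDens_nonneg {k : ℕ} {V : Evec k → ℝ} (hV : ∀ y, 0 ≤ V y) {ε : ℝ} (hε : 0 < ε)
    (u : E2 → Evec k) (y : E2) : 0 ≤ eDens V ε u y :=
  add_nonneg (mul_nonneg (by positivity) (gradSq_nonneg u y))
    (mul_nonneg (by positivity) (hV _))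

theorem gradSq_le_eDens {k : ℕ} {V : Evec k → ℝ} (hV : ∀ y, 0 ≤ V y) {ε : ℝ} (hε : 0 < ε)
    (u : E2 → Evec k) (y : E2) : ε * gradSq u y ≤ 2 * eDens V ε u y := by
  have : 0 ≤ ε⁻¹ * V (u y) := mul_nonneg (by positivity) (hV _)
  rw [eDens]
  linarith

theorem continuousOn_gradSq {k : ℕ} {u : E2 → Evec k} {Ω : Set E2} (hΩ : IsOpen Ω)
    (hu : ContDiffOn ℝ (⊤ : ℕ∞) u Ω) : ContinuousOn (gradSq u) Ω := by
  have h : gradSq u = fun y => ‖pder u 0 y‖ ^ 2 + ‖pder u 1 y‖ ^ 2 := funext (gradSq_eq u)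
  rw [h]
  exact ((contDiffOn_pder hΩ hu 0).continuousOn.norm.pow 2).add
    ((contDiffOn_pder hΩ hu 1).continuousOn.norm.pow 2)

/-- Testing the equation with a truncation of `u - σ` bounds the gradient where `u` is near `σ`. -/
theorem integral_gradSq_near_zero_le {k : ℕ} {V : Evec k → ℝ}
    (hV0 : ∀ y, 0 ≤ V y) {ε : ℝ} (hε : 0 < ε) {u : E2 → Evec k} {Ω : Set E2} (hΩ : IsOpen Ω)
    (hΩb : IsBounded Ω) (hu : IsSolution V ε Ω u) (hint : IntegrableOn (eDens V ε u) Ω) {M₀ : ℝ}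
    (hbd : energy V ε u Ω ≤ M₀) {σ : Evec k} {δ κ B : ℝ}
    (hσ : ∀ y, ‖y - σ‖ ^ 2 ≤ δ → 0 ≤ fderiv ℝ V y (y - σ)) {P : ℝ → ℝ}
    (hP : ContDiff ℝ (⊤ : ℕ∞) P) (hP0 : ∀ t, 0 ≤ P t) (hP1 : ∀ t, P t ≤ 1)
    (hPδ : ∀ t, δ ≤ t → P t = 0) (hκ : 0 ≤ κ) (hPκ : ∀ t, |t * deriv P t| ≤ κ) {χ : E2 → ℝ}
    (hχ : ContDiff ℝ 1 χ) (hχc : HasCompactSupport χ) (hχΩ : tsupport χ ⊆ Ω)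
    (hχ0 : ∀ y, 0 ≤ χ y) (hχ1 : ∀ y, χ y ≤ 1) (hB0 : 0 ≤ B)
    (hB : ∀ y i, |fderiv ℝ χ y (b2 i)| ≤ B) :
    Integrable (fun y => χ y * (P (‖u y - σ‖ ^ 2) * (ε * gradSq u y))) ∧
    ∫ y, χ y * (P (‖u y - σ‖ ^ 2) * (ε * gradSq u y))
      ≤ 4 * κ * M₀ + B * √δ * √ε * ((volume Ω).toReal + M₀) := by
  have hus := hu.1
  have hvol : volume Ω ≠ ⊤ := hΩb.measure_lt_top.ne
  have hf : ContDiffOn ℝ (⊤ : ℕ∞) (fun y => ‖u y - σ‖ ^ 2) Ω :=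
    (hus.sub contDiffOn_const).norm_sq ℝ
  have hPf : ContDiffOn ℝ (⊤ : ℕ∞) (fun y => P (‖u y - σ‖ ^ 2)) Ω := hP.comp_contDiffOn hf
  set w : Fin 2 → E2 → ℝ := fun i y => ⟪u y - σ, pder u i y⟫ with hw
  have hwd : ∀ i, ContDiffOn ℝ (⊤ : ℕ∞) (w i) Ω := fun i =>
    (hus.sub contDiffOn_const).inner ℝ (contDiffOn_pder hΩ hus i)
  set G : Fin 2 → E2 → ℝ := fun i y => P (‖u y - σ‖ ^ 2) * w i y with hG
  have hGd : ∀ i, ContDiffOn ℝ 1 (G i) Ω := fun i => (hPf.mul (hwd i)).of_le (by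
    exact WithTop.coe_le_coe.2 le_top)
  have hGder : ∀ y ∈ Ω, ∀ i, fderiv ℝ (G i) y (b2 i)
      = 2 * deriv P (‖u y - σ‖ ^ 2) * w i y ^ 2 + P (‖u y - σ‖ ^ 2) *
        (‖pder u i y‖ ^ 2 + ⟪u y - σ, fderiv ℝ (pder u i) y (b2 i)⟫) := by
    intro y hy i
    have hud : HasFDerivAt (fun z => u z - σ) (fderiv ℝ u y) y :=
      (((hus.contDiffAt (hΩ.mem_nhds hy)).differentiableAt (by simp)).hasFDerivAt).sub_const σ
    have h1 := hud.norm_sq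
    have h2 : HasDerivAt P (deriv P (‖u y - σ‖ ^ 2)) (‖u y - σ‖ ^ 2) :=
      (hP.differentiable (by simp) _).hasDerivAt
    have h3 := (h2.comp_hasFDerivAt y h1).fun_mul
      (hud.inner ℝ (hasFDerivAt_pder hΩ hus i hy))
    have hp : fderiv ℝ u y (b2 i) = pder u i y := rfl
    have h4 : fderiv ℝ (G i) y = _ := h3.fderiv
    rw [h4]
    simp only [add_apply, smul_apply, ContinuousLinearMap.comp_apply,
      ContinuousLinearMap.prod_apply, fderivInnerCLM_apply, smul_eq_mul, innerSL_apply_apply, hp,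
      real_inner_self_eq_norm_sq, nsmul_eq_mul, Function.comp_apply, hw]
    push_cast
    ring
  have hmain := fun i => integral_cutoff_mul_fderiv hΩ hχ hχc (hGd i) hχΩ (b2 i)
  set Ψ : E2 → ℝ := fun y => (χ y * fderiv ℝ (G 0) y (b2 0) + fderiv ℝ χ y (b2 0) * G 0 y)
    + (χ y * fderiv ℝ (G 1) y (b2 1) + fderiv ℝ χ y (b2 1) * G 1 y) with hΨ
  have hΨi : Integrable Ψ :=
    ((hmain 0).1.add (hmain 0).2.1).add ((hmain 1).1.add (hmain 1).2.1)
  have hΨ0 : ∫ y, Ψ y = 0 := by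
    simp only [hΨ]
    rw [integral_add ((hmain 0).1.fun_add (hmain 0).2.1) ((hmain 1).1.fun_add (hmain 1).2.1),
      integral_add (hmain 0).1 (hmain 0).2.1, integral_add (hmain 1).1 (hmain 1).2.1,
      (hmain 0).2.2, (hmain 1).2.2]
    ring
  have hΨΩ : ∫ y in Ω, Ψ y = 0 := by
    rw [setIntegral_eq_integral_of_forall_compl_eq_zero, hΨ0]
    intro y hy
    have hy' : y ∉ tsupport χ := fun h => hy (hχΩ h)
    have h2 : fderiv ℝ χ y = 0 :=
      image_eq_zero_of_notMem_tsupport fun h => hy' (tsupport_fderiv_subset ℝ h)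
    simp [hΨ, h2, image_eq_zero_of_notMem_tsupport hy']
  have hLc : Continuous fun y => χ y * (P (‖u y - σ‖ ^ 2) * (ε * gradSq u y)) :=
    continuous_mul_of_tsupport_subset hΩ hχ.continuous (hPf.continuousOn.mul
      (continuousOn_const.mul (continuousOn_gradSq hΩ hus))) hχΩ
  have hLi := hLc.integrable_of_hasCompactSupport (μ := volume) hχc.mul_right
  refine ⟨hLi, ?_⟩
  have hpt : ∀ y ∈ Ω, χ y * (P (‖u y - σ‖ ^ 2) * (ε * gradSq u y)) ≤
      ε * Ψ y + 4 * κ * eDens V ε u y + B * √δ * √ε * (1 + eDens V ε u y) := by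
    intro y hy
    have hE := gradSq_le_eDens hV0 hε u y
    have hg := gradSq_eq u y
    have hws : ∀ i, w i y ^ 2 ≤ ‖u y - σ‖ ^ 2 * ‖pder u i y‖ ^ 2 := by
      intro i
      rw [← mul_pow, ← sq_abs]
      exact pow_le_pow_left₀ (abs_nonneg _) (abs_real_inner_le_norm _ _) 2
    have hGb : ∀ i, |G i y| ≤ √δ * ‖pder u i y‖ := by
      intro i
      simp only [hG]
      rcases le_total δ (‖u y - σ‖ ^ 2) with h | h
      · rw [hPδ _ h, zero_mul, abs_zero]; positivity
      · have hs : ‖u y - σ‖ ≤ √δ := Real.le_sqrt_of_sq_le h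
        rw [abs_mul, abs_of_nonneg (hP0 _)]
        calc P (‖u y - σ‖ ^ 2) * |w i y| ≤ 1 * (‖u y - σ‖ * ‖pder u i y‖) := by
              gcongr
              · exact hP1 _
              · exact abs_real_inner_le_norm _ _
          _ ≤ √δ * ‖pder u i y‖ := by rw [one_mul]; gcongr
    have hbdry : ∀ i, -(ε * (fderiv ℝ χ y (b2 i) * G i y))
        ≤ B * √δ * √ε * ((1 + ε * ‖pder u i y‖ ^ 2) / 2) := by
      intro i
      have h1 : |fderiv ℝ χ y (b2 i) * G i y| ≤ B * (√δ * ‖pder u i y‖) := by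
        rw [abs_mul]
        exact mul_le_mul (hB y i) (hGb i) (abs_nonneg _) hB0
      have h2 : ε * ‖pder u i y‖ ≤ √ε * ((1 + ε * ‖pder u i y‖ ^ 2) / 2) := by
        have h3 : ε = √ε ^ 2 := (Real.sq_sqrt hε.le).symm
        have h4 : 0 ≤ √ε := Real.sqrt_nonneg _
        generalize √ε = t at *
        subst h3
        nlinarith [mul_nonneg h4 (sq_nonneg (1 - t * ‖pder u i y‖))]
      calc -(ε * (fderiv ℝ χ y (b2 i) * G i y)) ≤ ε * (B * (√δ * ‖pder u i y‖)) := by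
            have := (abs_le.1 h1).1
            nlinarith
        _ = B * √δ * (ε * ‖pder u i y‖) := by ring
        _ ≤ B * √δ * (√ε * ((1 + ε * ‖pder u i y‖ ^ 2) / 2)) := by gcongr
        _ = _ := by ring
    have hdiv : P (‖u y - σ‖ ^ 2) * gradSq u y - 2 * κ * gradSq u y
        ≤ fderiv ℝ (G 0) y (b2 0) + fderiv ℝ (G 1) y (b2 1) := by
      rw [hGder y hy, hGder y hy]
      have h1 : 0 ≤ P (‖u y - σ‖ ^ 2) * (⟪u y - σ, fderiv ℝ (pder u 0) y (b2 0)⟫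
          + ⟪u y - σ, fderiv ℝ (pder u 1) y (b2 1)⟫) := by
        rcases le_total δ (‖u y - σ‖ ^ 2) with h | h
        · rw [hPδ _ h, zero_mul]
        · have h2 := hσ _ h
          rw [fderiv_potential_apply hε hu hy, real_inner_comm, inner_add_right] at h2
          exact mul_nonneg (hP0 _) (nonneg_of_mul_nonneg_right h2 (by positivity))
      have h2 : |deriv P (‖u y - σ‖ ^ 2)| * (w 0 y ^ 2 + w 1 y ^ 2) ≤ κ * gradSq u y := by
        calc |deriv P (‖u y - σ‖ ^ 2)| * (w 0 y ^ 2 + w 1 y ^ 2)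
            ≤ |deriv P (‖u y - σ‖ ^ 2)| * (‖u y - σ‖ ^ 2 * gradSq u y) := by
              gcongr
              rw [hg]
              linarith [hws 0, hws 1]
          _ = |‖u y - σ‖ ^ 2 * deriv P (‖u y - σ‖ ^ 2)| * gradSq u y := by
              rw [abs_mul, abs_of_nonneg (sq_nonneg ‖u y - σ‖)]; ring
          _ ≤ κ * gradSq u y := mul_le_mul_of_nonneg_right (hPκ _) (gradSq_nonneg u y)
      have h3 : -(κ * gradSq u y) ≤ deriv P (‖u y - σ‖ ^ 2) * (w 0 y ^ 2 + w 1 y ^ 2) := by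
        have := neg_abs_le (deriv P (‖u y - σ‖ ^ 2))
        nlinarith [sq_nonneg (w 0 y), sq_nonneg (w 1 y)]
      rw [hg] at h3 ⊢
      linarith
    have hχdiv := mul_le_mul_of_nonneg_left hdiv (mul_nonneg hε.le (hχ0 y))
    have hχκ : χ y * (2 * κ * (ε * gradSq u y)) ≤ 1 * (2 * κ * (2 * eDens V ε u y)) := by
      have := gradSq_nonneg u y
      have := hχ0 y
      gcongr
      exact hχ1 y
    have hb0 := hbdry 0
    have hb1 := hbdry 1
    have hsum : B * √δ * √ε * ((1 + ε * ‖pder u 0 y‖ ^ 2) / 2)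
        + B * √δ * √ε * ((1 + ε * ‖pder u 1 y‖ ^ 2) / 2)
        ≤ B * √δ * √ε * (1 + eDens V ε u y) := by
      rw [← mul_add]
      refine mul_le_mul_of_nonneg_left ?_ (by positivity)
      rw [hg] at hE
      linarith
    simp only [hΨ]
    linarith
  have hone : IntegrableOn (fun _ : E2 => (1 : ℝ)) Ω := integrableOn_const hvol
  have hR : IntegrableOn (fun y => ε * Ψ y + 4 * κ * eDens V ε u y
      + B * √δ * √ε * (1 + eDens V ε u y)) Ω :=
    ((hΨi.integrableOn.const_mul _).add (hint.const_mul _)).add ((hone.add hint).const_mul _)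
  calc ∫ y, χ y * (P (‖u y - σ‖ ^ 2) * (ε * gradSq u y))
      = ∫ y in Ω, χ y * (P (‖u y - σ‖ ^ 2) * (ε * gradSq u y)) := by
        rw [setIntegral_eq_integral_of_forall_compl_eq_zero]
        intro y hy
        rw [image_eq_zero_of_notMem_tsupport fun h => hy (hχΩ h), zero_mul]
    _ ≤ ∫ y in Ω, (ε * Ψ y + 4 * κ * eDens V ε u y + B * √δ * √ε * (1 + eDens V ε u y)) :=
        setIntegral_mono_on hLi.integrableOn hR hΩ.measurableSet hpt
    _ = 4 * κ * energy V ε u Ω + B * √δ * √ε * ((volume Ω).toReal + energy V ε u Ω) := by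
        rw [integral_add ((hΨi.integrableOn.const_mul _).fun_add (hint.const_mul _))
          ((hone.fun_add hint).const_mul _), integral_add (hΨi.integrableOn.const_mul _)
          (hint.const_mul _), integral_const_mul, integral_const_mul, integral_const_mul, hΨΩ,
          integral_add hone hint]
        simp [energy, Measure.real]
    _ ≤ _ := by gcongr

theorem norm_b2 (i : Fin 2) : ‖b2 i‖ = 1 := by simp [b2]

theorem eventually_volume_gradSq_near_zero_le {k : ℕ} {V : Evec k → ℝ} (hV : IsMultiWell V)
    {Ω : Set E2} (hΩo : IsOpen Ω) (hΩb : IsBounded Ω) {M₀ : ℝ} (hM₀ : 0 < M₀)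
    {ε : ℕ → ℝ} {u : ℕ → E2 → Evec k} (hε : ∀ n, 0 < ε n) (hε0 : Tendsto ε atTop (𝓝 0))
    (hsol : ∀ n, IsSolution V (ε n) Ω (u n))
    (hint : ∀ n, IntegrableOn (eDens V (ε n) (u n)) Ω)
    (hbd : ∀ n, energy V (ε n) (u n) Ω ≤ M₀) {x₀ : E2} {ρ r κ τ : ℝ} (hr : 0 < r) (hrρ : r < ρ)
    (hρΩ : ball x₀ ρ ⊆ Ω) (hκ : 0 < κ) (hτ : 0 < τ) {σ : Evec k} (hσ : V σ = 0) :
    ∃ s > 0, ∀ᶠ n in atTop,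
      volume {y ∈ ball x₀ r | ‖u n y - σ‖ ^ 2 ≤ s ∧ κ ≤ ε n * gradSq (u n) y}
        ≤ ENNReal.ofReal τ := by
  obtain ⟨δ, hδ, hδσ⟩ := exists_fderiv_sub_nonneg hV hσ
  obtain ⟨s, hs, P, hP, hP0, hP1, hPs, hPδ, hPκ⟩ :=
    exists_log_cutoff (κ := κ * τ / (8 * M₀)) (by positivity) hδ
  let χ : ContDiffBump x₀ := ⟨r, (r + ρ) / 2, hr, by linarith⟩
  have hχΩ : tsupport χ ⊆ Ω := by
    rw [χ.tsupport_eq]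
    exact (closedBall_subset_ball (by change (r + ρ) / 2 < ρ; linarith)).trans hρΩ
  have hχd : ContDiff ℝ 1 χ := χ.contDiff
  have hχc := χ.hasCompactSupport
  obtain ⟨B, hB⟩ := (hχc.fderiv ℝ).exists_bound_of_continuous (hχd.continuous_fderiv (by simp))
  have hB0 : 0 ≤ B := (norm_nonneg _).trans (hB x₀)
  have hBi : ∀ y i, |fderiv ℝ χ y (b2 i)| ≤ B := fun y i =>
    ((fderiv ℝ χ y).le_opNorm (b2 i)).trans (by rw [norm_b2, mul_one]; exact hB y)
  have hlim : Tendsto (fun n => B * √δ * √(ε n) * ((volume Ω).toReal + M₀)) atTop (𝓝 0) := by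
    have h1 : Tendsto (fun n => √(ε n)) atTop (𝓝 0) := by
      simpa using hε0.sqrt
    simpa using (h1.const_mul (B * √δ)).mul_const ((volume Ω).toReal + M₀)
  refine ⟨s, hs, ?_⟩
  filter_upwards [hlim.eventually (ge_mem_nhds (show 0 < κ * τ / 2 by positivity))] with n hn
  obtain ⟨hi, hle⟩ := integral_gradSq_near_zero_le hV.nonneg (hε n) hΩo hΩb (hsol n) (hint n)
    (hbd n) hδσ hP hP0 hP1 hPδ (by positivity) hPκ hχd hχc hχΩ (fun _ => χ.nonneg)
    (fun _ => χ.le_one) hB0 hBi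
  have hf0 : ∀ y, 0 ≤ χ y * (P (‖u n y - σ‖ ^ 2) * (ε n * gradSq (u n) y)) := fun y =>
    mul_nonneg χ.nonneg (mul_nonneg (hP0 _) (mul_nonneg (hε n).le (gradSq_nonneg _ _)))
  have hcheb := mul_meas_ge_le_integral_of_nonneg (Eventually.of_forall hf0) hi κ
  have hsub : {y ∈ ball x₀ r | ‖u n y - σ‖ ^ 2 ≤ s ∧ κ ≤ ε n * gradSq (u n) y} ⊆
      {y | κ ≤ χ y * (P (‖u n y - σ‖ ^ 2) * (ε n * gradSq (u n) y))} := by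
    rintro y ⟨hy, hys, hyκ⟩
    have h1 : χ y = 1 := χ.one_of_mem_closedBall (ball_subset_closedBall hy)
    simpa [h1, hPs _ (by positivity) hys] using hyκ
  have hfin : volume {y | κ ≤ χ y * (P (‖u n y - σ‖ ^ 2) * (ε n * gradSq (u n) y))} ≠ ⊤ :=
    (hi.measure_ge_lt_top hκ).ne
  refine (measure_mono hsub).trans ((ENNReal.le_ofReal_iff_toReal_le hfin hτ.le).2 ?_)
  have h4 : 4 * (κ * τ / (8 * M₀)) * M₀ = κ * τ / 2 := by field_simp; ring
  rw [h4] at hle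
  have : κ * (volume {y | κ ≤ χ y * (P (‖u n y - σ‖ ^ 2) * (ε n * gradSq (u n) y))}).toReal
      ≤ κ * τ := hcheb.trans (by linarith)
  exact le_of_mul_le_mul_left this hκ

/-- Away from a set of small measure, points where the potential energy density stays bounded
carry little kinetic energy density. -/
theorem eventually_volume_gradSq_ge_le {k : ℕ} {V : Evec k → ℝ} (hV : IsMultiWell V)
    {Ω : Set E2} (hΩo : IsOpen Ω) (hΩb : IsBounded Ω) {M₀ : ℝ} (hM₀ : 0 < M₀)
    {ε : ℕ → ℝ} {u : ℕ → E2 → Evec k} (hε : ∀ n, 0 < ε n) (hε0 : Tendsto ε atTop (𝓝 0))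
    (hsol : ∀ n, IsSolution V (ε n) Ω (u n))
    (hint : ∀ n, IntegrableOn (eDens V (ε n) (u n)) Ω)
    (hbd : ∀ n, energy V (ε n) (u n) Ω ≤ M₀) {x₀ : E2} {ρ r κ τ : ℝ} (hr : 0 < r) (hrρ : r < ρ)
    (hρΩ : ball x₀ ρ ⊆ Ω) (hκ : 0 < κ) (hτ : 0 < τ) (C : ℝ) :
    ∀ᶠ n in atTop,
      volume {y ∈ ball x₀ r | V (u n y) ≤ C * ε n ∧ κ ≤ ε n * gradSq (u n) y}
        ≤ ENNReal.ofReal τ := by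
  set Z := hV.finite_zeros.toFinset with hZ
  have hZm : ∀ σ, σ ∈ Z ↔ V σ = 0 := fun σ => by simp [hZ]
  have hZc : 0 < (Z.card : ℝ) := by
    have h2 := hV.two_le_card
    rw [Set.ncard_eq_toFinset_card _ hV.finite_zeros] at h2
    exact_mod_cast lt_of_lt_of_le two_pos h2
  have hZne : Z.Nonempty := Finset.card_pos.1 (by exact_mod_cast hZc)
  have hloc := fun σ : Z => eventually_volume_gradSq_near_zero_le hV hΩo hΩb hM₀ hε hε0 hsol hint
    hbd hr hrρ hρΩ hκ (div_pos hτ hZc) ((hZm σ).1 σ.2)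
  choose s hs hsn using hloc
  have : Nonempty Z := hZne.to_subtype
  obtain ⟨σ₀, hσ₀⟩ := Finite.exists_min s
  obtain ⟨t, ht, hnear⟩ := exists_near_zero_of_potential_le hV (hs σ₀)
  have hCε : Tendsto (fun n => C * ε n) atTop (𝓝 0) := by simpa using hε0.const_mul C
  filter_upwards [hCε.eventually (ge_mem_nhds ht), eventually_all.2 hsn] with n hn hall
  have hsub : {y ∈ ball x₀ r | V (u n y) ≤ C * ε n ∧ κ ≤ ε n * gradSq (u n) y} ⊆
      ⋃ σ ∈ (Finset.univ : Finset Z),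
        {y ∈ ball x₀ r | ‖u n y - σ‖ ^ 2 ≤ s σ ∧ κ ≤ ε n * gradSq (u n) y} := by
    rintro y ⟨hy, hyV, hyκ⟩
    obtain ⟨σ, hσ, hle⟩ := hnear _ (hyV.trans hn)
    simp only [Set.mem_iUnion]
    exact ⟨⟨σ, (hZm σ).2 hσ⟩, Finset.mem_univ _, hy, hle.trans (hσ₀ _), hyκ⟩
  refine (measure_mono hsub).trans ((measure_biUnion_finset_le _ _).trans
    ((Finset.sum_le_sum fun σ _ => hall σ).trans ?_))
  rw [Finset.sum_const, Finset.card_univ, Fintype.card_coe, ← ENNReal.ofReal_nsmul, nsmul_eq_mul,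
    mul_div_cancel₀ _ hZc.ne']

/-- Profiles of radial cutoff functions, as functions of the squared radius. -/
structure IsProfile (q : ℝ → ℝ) : Prop where
  smooth : ContDiff ℝ (⊤ : ℕ∞) q
  antitone : Antitone q
  eq_zero : ∀ w, 1 ≤ w → q w = 0
  map_zero : q 0 = 1

/-- The weight `η` with `∇(q(‖z‖²)) = -η(z) z`. -/
def radWeight (q : ℝ → ℝ) (z : E2) : ℝ := -2 * deriv q (‖z‖ ^ 2)

/-- The average of `ψ` around `c` at scale `a`, with (unnormalised) radial weight. -/
def radAvg {F : Type*} [NormedAddCommGroup F] [NormedSpace ℝ F] (q : ℝ → ℝ) (a : ℝ)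
    (ψ : E2 → F) (c : E2) : F := ∫ z, radWeight q z • ψ (c + a • z)

namespace IsProfile

variable {q : ℝ → ℝ}

theorem nonneg (hq : IsProfile q) (w : ℝ) : 0 ≤ q w := by
  have h1 : 0 ≤ q (max w 1) := (hq.eq_zero _ (le_max_right _ _)).ge
  exact h1.trans (hq.antitone (le_max_left _ _))

theorem le_one (hq : IsProfile q) {w : ℝ} (hw : 0 ≤ w) : q w ≤ 1 :=
  hq.map_zero ▸ hq.antitone hw

theorem contDiff_comp (hq : IsProfile q) : ContDiff ℝ (⊤ : ℕ∞) fun z : E2 => q (‖z‖ ^ 2) :=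
  hq.smooth.comp (contDiff_id.norm_sq ℝ)

theorem tsupport_subset (hq : IsProfile q) :
    tsupport (fun z : E2 => q (‖z‖ ^ 2)) ⊆ closedBall 0 1 := by
  refine closure_minimal (fun z hz => ?_) isClosed_closedBall
  rw [mem_closedBall_zero_iff]
  by_contra! h
  exact hz (hq.eq_zero _ (by nlinarith))

theorem hasCompactSupport (hq : IsProfile q) : HasCompactSupport fun z : E2 => q (‖z‖ ^ 2) :=
  (isCompact_closedBall 0 1).of_isClosed_subset (isClosed_tsupport _) hq.tsupport_subset

theorem hasFDerivAt (hq : IsProfile q) (z : E2) :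
    HasFDerivAt (fun z : E2 => q (‖z‖ ^ 2)) (-radWeight q z • innerSL ℝ z) z := by
  have h2 : HasDerivAt q (deriv q (‖z‖ ^ 2)) (‖z‖ ^ 2) :=
    (hq.smooth.differentiable (by simp) _).hasDerivAt
  have h3 := h2.comp_hasFDerivAt z (hasFDerivAt_id z).norm_sq
  refine HasFDerivAt.congr_fderiv h3 ?_
  ext1 v
  simp only [radWeight, smul_apply, ContinuousLinearMap.comp_apply, innerSL_apply_apply,
    nsmul_eq_mul, smul_eq_mul, ContinuousLinearMap.id_apply, id]
  push_cast
  ring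

theorem radWeight_nonneg (hq : IsProfile q) (z : E2) : 0 ≤ radWeight q z := by
  have := hq.antitone.deriv_nonpos (x := ‖z‖ ^ 2)
  rw [radWeight]
  linarith

theorem continuous_radWeight (hq : IsProfile q) : Continuous (radWeight q) :=
  ((hq.smooth.continuous_deriv (by simp)).comp (continuous_norm.pow 2)).const_mul _

theorem radWeight_eq_zero (hq : IsProfile q) {z : E2} (hz : 1 < ‖z‖) : radWeight q z = 0 := by
  have h : q =ᶠ[𝓝 (‖z‖ ^ 2)] fun _ => 0 := by
    filter_upwards [Ioi_mem_nhds (show 1 < ‖z‖ ^ 2 by nlinarith)] with w hw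
    exact hq.eq_zero w (le_of_lt hw)
  rw [radWeight, h.deriv_eq]
  simp

theorem norm_le_one (hq : IsProfile q) {z : E2} (hz : radWeight q z ≠ 0) : ‖z‖ ≤ 1 := by
  by_contra! h
  exact hz (hq.radWeight_eq_zero h)

theorem hasCompactSupport_radWeight (hq : IsProfile q) : HasCompactSupport (radWeight q) :=
  HasCompactSupport.intro (isCompact_closedBall (0 : E2) 1) fun z hz =>
    hq.radWeight_eq_zero (by simpa using hz)

theorem integral_radWeight_pos (hq : IsProfile q) : 0 < ∫ z, radWeight q z := by
  have hne : ∃ z, radWeight q z ≠ 0 := by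
    by_contra! h
    have hd : ∀ z : E2, fderiv ℝ (fun z : E2 => q (‖z‖ ^ 2)) z = 0 := fun z => by
      rw [(hq.hasFDerivAt z).fderiv, h z]
      simp
    have h1 := is_const_of_fderiv_eq_zero (hq.contDiff_comp.differentiable (by simp)) hd 0 (b2 0)
    simp [norm_b2, hq.map_zero, hq.eq_zero 1 le_rfl] at h1
  obtain ⟨z, hz⟩ := hne
  exact hq.continuous_radWeight.integral_pos_of_hasCompactSupport_nonneg_nonzero
    hq.hasCompactSupport_radWeight hq.radWeight_nonneg hz

theorem integrable_radWeight (hq : IsProfile q) : Integrable (radWeight q) :=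
  hq.continuous_radWeight.integrable_of_hasCompactSupport hq.hasCompactSupport_radWeight

theorem integrable_radWeight_smul {F : Type*} [NormedAddCommGroup F] [NormedSpace ℝ F]
    (hq : IsProfile q) {ψ : E2 → F} (hψ : Continuous ψ) (a : ℝ) (c : E2) :
    Integrable fun z => radWeight q z • ψ (c + a • z) :=
  (hq.continuous_radWeight.smul (hψ.comp (by fun_prop))).integrable_of_hasCompactSupport
    hq.hasCompactSupport_radWeight.smul_right

theorem exists_radWeight_le (hq : IsProfile q) : ∃ K > 0, ∀ z, radWeight q z ≤ K := by
  obtain ⟨K, hK⟩ := hq.hasCompactSupport_radWeight.exists_bound_of_continuous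
    hq.continuous_radWeight
  exact ⟨max K 1, by positivity, fun z => (le_abs_self _).trans ((hK z).trans (le_max_left _ _))⟩

theorem hasFDerivAt_radAvg {F : Type*} [NormedAddCommGroup F] [NormedSpace ℝ F]
    (hq : IsProfile q) {ψ : E2 → F} (hψ : ContDiff ℝ 1 ψ) (hψc : HasCompactSupport ψ)
    (a : ℝ) (c : E2) : HasFDerivAt (radAvg q a ψ) (radAvg q a (fderiv ℝ ψ) c) c := by
  have hψ' : Continuous (fderiv ℝ ψ) := hψ.continuous_fderiv (by simp)
  obtain ⟨B, hB⟩ := (hψc.fderiv ℝ).exists_bound_of_continuous hψ'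
  refine hasFDerivAt_integral_of_dominated_of_fderiv_le
    (bound := fun z => radWeight q z * B) (F' := fun c z => radWeight q z • fderiv ℝ ψ (c + a • z))
    univ_mem
    (Eventually.of_forall fun x => (hq.integrable_radWeight_smul hψ.continuous a x).1)
    (hq.integrable_radWeight_smul hψ.continuous a c)
    (hq.integrable_radWeight_smul hψ' a c).1
    (Eventually.of_forall fun z x _ => ?_) (hq.integrable_radWeight.mul_const B)
    (Eventually.of_forall fun z x _ => ?_)
  · rw [norm_smul, Real.norm_of_nonneg (hq.radWeight_nonneg z)]
    exact mul_le_mul_of_nonneg_left (hB _) (hq.radWeight_nonneg z)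
  · have h1 : HasFDerivAt ψ (fderiv ℝ ψ (x + a • z)) (x + a • z) :=
      (hψ.differentiable (by simp) _).hasFDerivAt
    have h2 := h1.comp x ((hasFDerivAt_id x).add_const (a • z))
    rw [ContinuousLinearMap.comp_id] at h2
    exact h2.const_smul (radWeight q z)

theorem norm_radAvg_le {F : Type*} [NormedAddCommGroup F] [NormedSpace ℝ F] (hq : IsProfile q)
    {ψ : E2 → F} (hψ : Continuous ψ) {K : ℝ}
    (hK : ∀ z, radWeight q z ≤ K) {a : ℝ} (ha : 0 < a) {c : E2} {D : Set E2}
    (hψi : IntegrableOn (fun y => ‖ψ y‖) D) (hD : MeasurableSet D) (hcD : closedBall c a ⊆ D) :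
    ‖radAvg q a ψ c‖ ≤ K * (a ^ 2)⁻¹ * ∫ y in D, ‖ψ y‖ := by
  have hK0 : 0 ≤ K := (hq.radWeight_nonneg 0).trans (hK 0)
  set f : E2 → ℝ := D.indicator fun y => ‖ψ y‖ with hf
  have hfi : Integrable f := hψi.integrable_indicator hD
  have hcomp : ∫ z, f (c + a • z) = (a ^ 2)⁻¹ * ∫ y in D, ‖ψ y‖ := by
    rw [Measure.integral_comp_smul volume (fun y => f (c + y)) a, integral_add_left_eq_self f c,
      integral_indicator hD]
    simp [abs_of_pos ha]
  have hi : Integrable fun z => f (c + a • z) :=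
    (hfi.comp_add_left c).comp_smul ha.ne'
  calc ‖radAvg q a ψ c‖ ≤ ∫ z, ‖radWeight q z • ψ (c + a • z)‖ := norm_integral_le_integral_norm _
    _ ≤ ∫ z, K * f (c + a • z) := by
        refine integral_mono (hq.integrable_radWeight_smul hψ a c).norm (hi.const_mul K) fun z => ?_
        dsimp only
        rcases eq_or_ne (radWeight q z) 0 with h | h
        · rw [h, zero_smul, norm_zero]
          exact mul_nonneg hK0 (Set.indicator_nonneg (fun _ _ => norm_nonneg _) _)
        · have hz := hq.norm_le_one h
          have hm : c + a • z ∈ D := hcD (by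
            rw [mem_closedBall, dist_eq_norm, add_sub_cancel_left, norm_smul, Real.norm_of_nonneg
              ha.le]
            nlinarith)
          rw [norm_smul, Real.norm_of_nonneg (hq.radWeight_nonneg z), hf,
            Set.indicator_of_mem hm]
          exact mul_le_mul_of_nonneg_right (hK z) (norm_nonneg _)
    _ = K * (a ^ 2)⁻¹ * ∫ y in D, ‖ψ y‖ := by rw [integral_const_mul, hcomp, mul_assoc]

end IsProfile

theorem fderiv_fderiv_comp_affine {φ : E2 → ℝ} (hφ : ContDiff ℝ 2 φ) (a : ℝ) (c v z : E2) :
    fderiv ℝ (fun z => fderiv ℝ φ (c + a • z) v) z v = a * hess φ (c + a • z) v v := by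
  have h0 : HasFDerivAt (fun z : E2 => c + a • z) (a • ContinuousLinearMap.id ℝ E2) z :=
    ((hasFDerivAt_id z).const_smul a).const_add c
  have h1 := (hasFDerivAt_fderiv hφ (c + a • z)).comp z h0
  have h2 : HasFDerivAt (fun z => fderiv ℝ φ (c + a • z) v) _ z :=
    (ContinuousLinearMap.apply ℝ ℝ v).hasFDerivAt.comp z h1
  rw [h2.fderiv]
  simp

namespace IsProfile

variable {q : ℝ → ℝ}

theorem integral_radWeight_mul_fderiv (hq : IsProfile q) {φ : E2 → ℝ} (hφ : ContDiff ℝ 2 φ)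
    (a : ℝ) (c : E2) :
    ∫ z, radWeight q z * fderiv ℝ φ (c + a • z) z
      = a * ∫ z, q (‖z‖ ^ 2) * tr2 (hess φ (c + a • z)) := by
  have hφ' : ContDiff ℝ 1 (fderiv ℝ φ) := hφ.fderiv_right (by norm_num)
  have haff : ContDiff ℝ 1 fun z : E2 => c + a • z := by fun_prop
  have hφa : ContDiff ℝ 1 fun z => fderiv ℝ φ (c + a • z) := hφ'.comp haff
  have hQ1 : ContDiff ℝ 1 fun z : E2 => q (‖z‖ ^ 2) :=
    hq.contDiff_comp.of_le (WithTop.coe_le_coe.2 le_top)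
  have hQf : ∀ i z, fderiv ℝ (fun z : E2 => q (‖z‖ ^ 2)) z (b2 i) = -(radWeight q z * z i) := by
    intro i z
    rw [(hq.hasFDerivAt z).fderiv]
    simp [b2, EuclideanSpace.inner_single_right]
  have key : ∀ i, Integrable (fun z => q (‖z‖ ^ 2) * (a * hess φ (c + a • z) (b2 i) (b2 i))) ∧
      Integrable (fun z => -(radWeight q z * z i) * fderiv ℝ φ (c + a • z) (b2 i)) ∧
      ∫ z, q (‖z‖ ^ 2) * (a * hess φ (c + a • z) (b2 i) (b2 i))
        = -∫ z, -(radWeight q z * z i) * fderiv ℝ φ (c + a • z) (b2 i) := by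
    intro i
    have hGd : ContDiff ℝ 1 fun z => fderiv ℝ φ (c + a • z) (b2 i) :=
      hφa.clm_apply contDiff_const
    have h := integral_cutoff_mul_fderiv isOpen_univ hQ1 hq.hasCompactSupport
      hGd.contDiffOn (Set.subset_univ _) (b2 i)
    simpa only [hQf, fderiv_fderiv_comp_affine hφ] using h
  have e1 : ∀ z, radWeight q z * fderiv ℝ φ (c + a • z) z
      = -(-(radWeight q z * z 0) * fderiv ℝ φ (c + a • z) (b2 0)
        + -(radWeight q z * z 1) * fderiv ℝ φ (c + a • z) (b2 1)) := by
    intro z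
    have : fderiv ℝ φ (c + a • z) z
        = z 0 * fderiv ℝ φ (c + a • z) (b2 0) + z 1 * fderiv ℝ φ (c + a • z) (b2 1) := by
      generalize fderiv ℝ φ (c + a • z) = L
      conv_lhs => rw [E2_eq_sum z, map_add, map_smul, map_smul]
      rfl
    rw [this]
    ring
  have e2 : ∀ z, q (‖z‖ ^ 2) * (a * hess φ (c + a • z) (b2 0) (b2 0))
      + q (‖z‖ ^ 2) * (a * hess φ (c + a • z) (b2 1) (b2 1))
      = a * (q (‖z‖ ^ 2) * tr2 (hess φ (c + a • z))) := by
    intro z; rw [tr2]; ring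
  simp_rw [e1]
  rw [integral_neg, integral_add (key 0).2.1 (key 1).2.1, ← integral_const_mul]
  simp_rw [← e2]
  rw [integral_add (key 0).1 (key 1).1, (key 0).2.2, (key 1).2.2]
  ring

theorem hasDerivAt_radAvg (hq : IsProfile q) {φ : E2 → ℝ} (hφ : ContDiff ℝ 2 φ)
    (hφc : HasCompactSupport φ) (c : E2) (a : ℝ) :
    HasDerivAt (fun a => radAvg q a φ c)
      (a * ∫ z, q (‖z‖ ^ 2) * tr2 (hess φ (c + a • z))) a := by
  have hφ' : Continuous (fderiv ℝ φ) := hφ.continuous_fderiv (by simp)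
  obtain ⟨B, hB⟩ := (hφc.fderiv ℝ).exists_bound_of_continuous hφ'
  have hB0 : 0 ≤ B := (norm_nonneg _).trans (hB 0)
  have hcont : Continuous fun z => radWeight q z * fderiv ℝ φ (c + a • z) z :=
    hq.continuous_radWeight.mul ((hφ'.comp (by fun_prop)).clm_apply continuous_id)
  rw [← hq.integral_radWeight_mul_fderiv hφ]
  refine (hasDerivAt_integral_of_dominated_loc_of_deriv_le
    (bound := fun z => radWeight q z * B) (F := fun a z => radWeight q z • φ (c + a • z))
    (F' := fun a z => radWeight q z * fderiv ℝ φ (c + a • z) z)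
    univ_mem
    (Eventually.of_forall fun x => (hq.integrable_radWeight_smul hφ.continuous x c).1)
    (hq.integrable_radWeight_smul hφ.continuous a c) hcont.aestronglyMeasurable
    (Eventually.of_forall fun z x _ => ?_) (hq.integrable_radWeight.mul_const B)
    (Eventually.of_forall fun z x _ => ?_)).2
  · rcases eq_or_ne (radWeight q z) 0 with h | h
    · simp [h]
    · rw [norm_mul, Real.norm_of_nonneg (hq.radWeight_nonneg z)]
      refine mul_le_mul_of_nonneg_left ?_ (hq.radWeight_nonneg z)
      calc ‖fderiv ℝ φ (c + x • z) z‖ ≤ ‖fderiv ℝ φ (c + x • z)‖ * ‖z‖ :=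
            ContinuousLinearMap.le_opNorm _ _
        _ ≤ B * 1 := mul_le_mul (hB _) (hq.norm_le_one h) (norm_nonneg _) hB0
        _ = B := mul_one B
  · have h1 : HasFDerivAt φ (fderiv ℝ φ (c + x • z)) (c + x • z) :=
      (hφ.differentiable (by simp) _).hasFDerivAt
    have h2 : HasDerivAt (fun x : ℝ => c + x • z) z x := by
      simpa using ((hasDerivAt_id x).smul_const z).const_add c
    exact (h1.comp_hasDerivAt x h2).const_mul (radWeight q z)

theorem continuous_integral_profile_mul (hq : IsProfile q) {f : E2 → ℝ} (hf : Continuous f)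
    (c : E2) : Continuous fun a : ℝ => ∫ z, q (‖z‖ ^ 2) * f (c + a • z) := by
  have h : ∀ a : ℝ, ∫ z, q (‖z‖ ^ 2) * f (c + a • z)
      = ∫ z in closedBall 0 1, q (‖z‖ ^ 2) * f (c + a • z) := by
    intro a
    rw [setIntegral_eq_integral_of_forall_compl_eq_zero]
    intro z hz
    rw [image_eq_zero_of_notMem_tsupport (f := fun z : E2 => q (‖z‖ ^ 2))
      fun h => hz (hq.tsupport_subset h), zero_mul]
  simp_rw [h]
  have hqc : Continuous fun z : E2 => q (‖z‖ ^ 2) := hq.contDiff_comp.continuous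
  exact continuous_parametric_integral_of_continuous
    ((hqc.comp continuous_snd).mul (hf.comp (by fun_prop))) (isCompact_closedBall 0 1)

theorem radAvg_zero {F : Type*} [NormedAddCommGroup F] [NormedSpace ℝ F] [CompleteSpace F]
    (ψ : E2 → F) (c : E2) : radAvg q 0 ψ c = (∫ z, radWeight q z) • ψ c := by
  simp only [radAvg, zero_smul, add_zero]
  exact integral_smul_const _ _

/-- The mean value inequality for subharmonic functions. -/
theorem le_radAvg (hq : IsProfile q) {φ : E2 → ℝ} (hφ : ContDiff ℝ 2 φ)
    (hφc : HasCompactSupport φ) {c : E2} {s : ℝ} (hs : 0 ≤ s)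
    (htr : ∀ y ∈ closedBall c s, 0 ≤ tr2 (hess φ y)) :
    (∫ z, radWeight q z) * φ c ≤ radAvg q s φ c := by
  have hd := hq.hasDerivAt_radAvg hφ hφc c
  have hmono : MonotoneOn (fun a => radAvg q a φ c) (Set.Icc 0 s) := by
    refine monotoneOn_of_deriv_nonneg (convex_Icc 0 s)
      (fun a _ => (hd a).continuousAt.continuousWithinAt)
      (fun a _ => (hd a).differentiableAt.differentiableWithinAt) fun a ha => ?_
    rw [interior_Icc] at ha
    rw [(hd a).deriv]
    refine mul_nonneg ha.1.le (integral_nonneg fun z => ?_)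
    rcases le_total ‖z‖ 1 with h | h
    · refine mul_nonneg (hq.nonneg _) (htr _ ?_)
      rw [mem_closedBall, dist_eq_norm, add_sub_cancel_left, norm_smul,
        Real.norm_of_nonneg ha.1.le]
      nlinarith [ha.1, ha.2]
    · rw [hq.eq_zero _ (by nlinarith), zero_mul]
      rfl
  have := hmono (Set.left_mem_Icc.2 hs) (Set.right_mem_Icc.2 hs) hs
  simpa only [radAvg_zero, smul_eq_mul] using this

theorem radAvg_comm (hq : IsProfile q) {φ : E2 → ℝ} (hφ : Continuous φ) (a b : ℝ) (c : E2) :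
    radAvg q a (radAvg q b φ) c = radAvg q b (radAvg q a φ) c := by
  simp only [radAvg, ← integral_smul]
  have hη := hq.continuous_radWeight
  have hc : Continuous (Function.uncurry fun z w : E2 =>
      radWeight q z • radWeight q w • φ (c + a • z + b • w)) :=
    (hη.comp continuous_fst).smul ((hη.comp continuous_snd).smul (hφ.comp (by fun_prop)))
  rw [integral_integral_swap_of_hasCompactSupport hc]
  · refine integral_congr_ae (Eventually.of_forall fun w => integral_congr_ae
      (Eventually.of_forall fun z => ?_))
    dsimp only
    rw [smul_comm, add_right_comm]
  · refine HasCompactSupport.intro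
      ((isCompact_closedBall (0 : E2) 1).prod (isCompact_closedBall (0 : E2) 1)) fun p hp => ?_
    have : 1 < ‖p.1‖ ∨ 1 < ‖p.2‖ := by
      by_contra! h
      exact hp ⟨by simpa using h.1, by simpa using h.2⟩
    rcases this with h | h <;> simp [Function.uncurry, hq.radWeight_eq_zero h]

theorem integral_radWeight_smul_self (q : ℝ → ℝ) (L : E2 →L[ℝ] ℝ) :
    ∫ z, radWeight q z * L z = 0 := by
  have h := integral_neg_eq_self (fun z => radWeight q z * L z) (volume : Measure E2)
  have e : ∀ z, radWeight q (-z) * L (-z) = -(radWeight q z * L z) := by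
    intro z; simp [radWeight]
  simp_rw [e, integral_neg] at h
  linarith

/-- Averaging at a small scale changes functions with Lipschitz gradient to second order. -/
theorem radAvg_le_add (hq : IsProfile q) {g : E2 → ℝ} (hg : Differentiable ℝ g)
    {c : E2} {s Λ : ℝ} (hs : 0 ≤ s) (hΛ : 0 ≤ Λ)
    (hlip : ∀ y ∈ closedBall c s, ∀ z ∈ closedBall c s,
      ‖fderiv ℝ g y - fderiv ℝ g z‖ ≤ Λ * ‖y - z‖) :
    radAvg q s g c ≤ (∫ z, radWeight q z) * (g c + Λ * s ^ 2) := by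
  have h0 := integral_radWeight_smul_self q (s • fderiv ℝ g c)
  have hi1 : Integrable fun z => radWeight q z * (s • fderiv ℝ g c) z :=
    (hq.continuous_radWeight.mul (s • fderiv ℝ g c).continuous).integrable_of_hasCompactSupport
      hq.hasCompactSupport_radWeight.mul_right
  have hi2 : Integrable fun z => radWeight q z * (g c + Λ * s ^ 2) :=
    hq.integrable_radWeight.mul_const _
  rw [← integral_mul_const, ← add_zero (∫ z, radWeight q z * (g c + Λ * s ^ 2)), ← h0,
    ← integral_add hi2 hi1]
  refine integral_mono (hq.integrable_radWeight_smul hg.continuous s c) (hi2.fun_add hi1)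
    fun z => ?_
  dsimp only
  rw [← mul_add, smul_eq_mul]
  rcases eq_or_ne (radWeight q z) 0 with h | h
  · simp [h]
  refine mul_le_mul_of_nonneg_left ?_ (hq.radWeight_nonneg z)
  have hz := hq.norm_le_one h
  have hn : ‖s • z‖ ≤ s := by
    rw [norm_smul, Real.norm_of_nonneg hs]; nlinarith
  have ht := abs_taylor_le_of_lipschitz_fderiv hg hlip hΛ
    (y := c + s • z) (z := c) (by simpa [mem_closedBall, dist_eq_norm] using hn)
    (mem_closedBall_self hs)
  rw [add_sub_cancel_left] at ht
  have h1 := (abs_le.1 ht).2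
  have h2 : ‖s • z‖ ^ 2 ≤ s ^ 2 := pow_le_pow_left₀ (norm_nonneg _) hn 2
  have h3 : (s • fderiv ℝ g c) z = fderiv ℝ g c (s • z) := by simp
  rw [h3]
  nlinarith [mul_le_mul_of_nonneg_left h2 hΛ]

end IsProfile

theorem hasCompactSupport_hess {φ : E2 → ℝ} (hφc : HasCompactSupport φ) :
    HasCompactSupport (hess φ) := HasCompactSupport.fderiv ℝ (hφc.fderiv ℝ)

theorem integrable_norm_hess {φ : E2 → ℝ} (hφ : ContDiff ℝ 2 φ) (hφc : HasCompactSupport φ) :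
    Integrable fun y => ‖hess φ y‖ :=
  (Continuous.norm (E := E2 →L[ℝ] E2 →L[ℝ] ℝ)
    (continuous_hess hφ)).integrable_of_hasCompactSupport
    (HasCompactSupport.norm (E := E2 →L[ℝ] E2 →L[ℝ] ℝ) (hasCompactSupport_hess hφc))

namespace IsProfile

variable {q : ℝ → ℝ}

theorem fderiv_radAvg (hq : IsProfile q) {φ : E2 → ℝ} (hφ : ContDiff ℝ 1 φ)
    (hφc : HasCompactSupport φ) (b : ℝ) :
    fderiv ℝ (radAvg q b φ) = radAvg q b (fderiv ℝ φ) :=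
  funext fun y => (hq.hasFDerivAt_radAvg hφ hφc b y).fderiv

theorem hasFDerivAt_radAvg_fderiv (hq : IsProfile q) {φ : E2 → ℝ} (hφ : ContDiff ℝ 2 φ)
    (hφc : HasCompactSupport φ) (b : ℝ) (y : E2) :
    HasFDerivAt (radAvg q b (fderiv ℝ φ)) (radAvg q b (hess φ) y) y := by
  have hφ' : ContDiff ℝ 1 (fderiv ℝ φ) := hφ.fderiv_right (by norm_num)
  exact hq.hasFDerivAt_radAvg hφ' (hφc.fderiv ℝ) b y

theorem norm_fderiv_radAvg_sub_le (hq : IsProfile q) {φ : E2 → ℝ} (hφ : ContDiff ℝ 2 φ)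
    (hφc : HasCompactSupport φ) {K M b r : ℝ} (hK : ∀ z, radWeight q z ≤ K) (hb : 0 < b)
    {D : Set E2} (hD : MeasurableSet D) (hM : ∫ y in D, ‖hess φ y‖ ≤ M) {c : E2}
    (hcD : ∀ y ∈ closedBall c r, closedBall y b ⊆ D) :
    ∀ y ∈ closedBall c r, ∀ z ∈ closedBall c r,
      ‖fderiv ℝ (radAvg q b φ) y - fderiv ℝ (radAvg q b φ) z‖
        ≤ K * (b ^ 2)⁻¹ * M * ‖y - z‖ := by
  have hK0 : 0 ≤ K := (hq.radWeight_nonneg 0).trans (hK 0)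
  have hhi : IntegrableOn (fun y => ‖hess φ y‖) D :=
    (integrable_norm_hess hφ hφc).integrableOn
  have hbd : ∀ x ∈ closedBall c r, ‖radAvg q b (hess φ) x‖ ≤ K * (b ^ 2)⁻¹ * M := fun x hx =>
    (hq.norm_radAvg_le (continuous_hess hφ) hK hb hhi hD (hcD x hx)).trans
      (mul_le_mul_of_nonneg_left hM (by positivity))
  intro y hy z hz
  rw [hq.fderiv_radAvg (hφ.of_le (by norm_num)) hφc]
  exact (convex_closedBall c r).norm_image_sub_le_of_norm_hasFDerivWithin_le
    (fun x _ => (hq.hasFDerivAt_radAvg_fderiv hφ hφc b x).hasFDerivWithinAt) hbd hz hy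

theorem radAvg_const_mul (m : ℝ) (a : ℝ) (φ : E2 → ℝ) (c : E2) :
    radAvg q a (fun y => m * φ y) c = m * radAvg q a φ c := by
  simp only [radAvg, ← integral_const_mul, smul_eq_mul]
  exact integral_congr_ae (Eventually.of_forall fun z => by ring)

/-- Approximate midpoint convexity in the radius of spherical averages of a subharmonic function
whose Hessian has, off a small set, a small negative part where the trace is bounded. -/
theorem exists_radAvg_midpoint (hq : IsProfile q) {x₀ : E2} {ρ a h M δ : ℝ} (ha : 0 < a)
    (hh : 0 < h) (hha : h ≤ a / 2) (hρ : a + 3 * h < ρ) (hM : 0 ≤ M) (hδ : 0 < δ) :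
    ∃ C > 0, ∃ κ > 0, ∃ m > 0, ∀ φ : E2 → ℝ, ContDiff ℝ 2 φ → HasCompactSupport φ →
      (∀ y ∈ ball x₀ ρ, 0 ≤ tr2 (hess φ y)) → ∫ y in ball x₀ ρ, ‖hess φ y‖ ≤ M →
      (∀ e : E2, ‖e‖ = 1 → volume {y ∈ ball x₀ ρ | hess φ y e e ≤ -κ ∧ tr2 (hess φ y) ≤ C}
        < ENNReal.ofReal m) →
      radAvg q a φ x₀ ≤ (radAvg q (a + h) φ x₀ + radAvg q (a - h) φ x₀) / 2 + δ := by
  obtain ⟨K, hK0, hK⟩ := hq.exists_radWeight_le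
  have hm₀ := hq.integral_radWeight_pos
  set m₀ := ∫ z, radWeight q z with hm₀_def
  set L := K * ((a / 2) ^ 2)⁻¹ * M with hL
  have hL0 : 0 ≤ L := by positivity
  obtain ⟨s, hs, hsh, hsL⟩ : ∃ s > 0, s ≤ h ∧ L * s ^ 2 ≤ δ / 2 := by
    refine ⟨min h (δ / (2 * (L * h + 1))), by positivity, min_le_left _ _, ?_⟩
    set s := min h (δ / (2 * (L * h + 1)))
    have h1 : s ≤ h := min_le_left _ _
    have h2 : s * (2 * (L * h + 1)) ≤ δ := (le_div_iff₀ (by positivity)).1 (min_le_right _ _)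
    have h3 : 0 < s := by positivity
    nlinarith [mul_le_mul_of_nonneg_left h1 (mul_nonneg hL0 h3.le)]
  set Λ := m₀⁻¹ * (K * (s ^ 2)⁻¹ * M) with hΛ
  have hΛ0 : 0 ≤ Λ := by positivity
  obtain ⟨C, hC, κ, hκ, m, hm, habp⟩ :=
    exists_abp_midpoint hΛ0 hh (δ := δ / (2 * m₀)) (by positivity)
  refine ⟨C, hC, κ, hκ, m, hm, fun φ hφ hφc htr hMφ hvol => ?_⟩
  set g : E2 → ℝ := fun y => m₀⁻¹ * radAvg q s φ y with hg
  have hrd : ∀ b, Differentiable ℝ (radAvg q b φ) := fun b y =>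
    (hq.hasFDerivAt_radAvg (hφ.of_le (by norm_num)) hφc b y).differentiableAt
  have hgd : Differentiable ℝ g := fun y => (hrd s y).const_mul _
  have hgf : ∀ y, fderiv ℝ g y = m₀⁻¹ • fderiv ℝ (radAvg q s φ) y := fun y =>
    ((hrd s y).hasFDerivAt.const_mul m₀⁻¹).fderiv
  have hpt : ∀ Y : E2, ‖Y‖ ≤ 1 → φ (x₀ + a • Y)
      ≤ (g (x₀ + (a + h) • Y) + g (x₀ + (a - h) • Y)) / 2 + δ / (2 * m₀) := by
    intro Y hY
    have hsub : ∀ y ∈ closedBall (x₀ + a • Y) (2 * h), closedBall y s ⊆ ball x₀ ρ := by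
      intro y hy z hz
      rw [mem_closedBall] at hy hz
      rw [mem_ball]
      have h1 : dist (x₀ + a • Y) x₀ ≤ a := by
        rw [dist_eq_norm, add_sub_cancel_left, norm_smul, Real.norm_of_nonneg ha.le]
        nlinarith
      linarith [dist_triangle z y x₀, dist_triangle y (x₀ + a • Y) x₀]
    have hle : ∀ y ∈ closedBall (x₀ + a • Y) (2 * h), φ y ≤ g y := by
      intro y hy
      have := hq.le_radAvg hφ hφc hs.le fun z hz => htr z (hsub y hy hz)
      rw [hg]
      dsimp only
      rw [← div_eq_inv_mul, le_div_iff₀ hm₀]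
      linarith
    rcases eq_or_ne Y 0 with rfl | hY0
    · have := hle (x₀ + a • (0 : E2)) (mem_closedBall_self (by positivity))
      simp only [smul_zero, add_zero] at this ⊢
      have h0 : 0 < δ / (2 * m₀) := by positivity
      linarith
    · have hYn : 0 < ‖Y‖ := norm_pos_iff.2 hY0
      have he : ‖‖Y‖⁻¹ • Y‖ = 1 := by
        rw [norm_smul, norm_inv, norm_norm, inv_mul_cancel₀ hYn.ne']
      have hle' : (h * ‖Y‖) • (‖Y‖⁻¹ • Y) = h • Y := by
        rw [smul_smul, mul_assoc, mul_inv_cancel₀ hYn.ne', mul_one]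
      have hmem : ∀ y ∈ closedBall (x₀ + a • Y) (2 * h), y ∈ ball x₀ ρ := fun y hy =>
        hsub y hy (mem_closedBall_self hs.le)
      have hres := habp φ g hφ hgd (x₀ + a • Y) (‖Y‖⁻¹ • Y) he (h * ‖Y‖) (by positivity)
        (by nlinarith) hle ?_ (fun y hy => htr y (hmem y hy)) ?_
      · rw [hle', add_assoc, add_sub_assoc, ← add_smul, ← sub_smul] at hres
        exact hres
      · intro y hy z hz
        rw [hgf, hgf, ← smul_sub, norm_smul, Real.norm_of_nonneg (by positivity), hΛ, mul_assoc]
        exact mul_le_mul_of_nonneg_left (hq.norm_fderiv_radAvg_sub_le hφ hφc hK hs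
          measurableSet_ball hMφ hsub y hy z hz) (by positivity)
      · refine (measure_mono fun y hy => ?_).trans_lt (hvol _ he)
        exact ⟨hmem y hy.1, hy.2⟩
  have hgi := fun b => hq.integrable_radWeight_smul hgd.continuous b x₀
  have hci : Integrable fun z => radWeight q z * (δ / (2 * m₀)) :=
    hq.integrable_radWeight.mul_const _
  have hsum : Integrable fun z => (radWeight q z • g (x₀ + (a + h) • z)
      + radWeight q z • g (x₀ + (a - h) • z)) / 2 + radWeight q z * (δ / (2 * m₀)) :=
    (((hgi (a + h)).fun_add (hgi (a - h))).div_const 2).fun_add hci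
  have hint : radAvg q a φ x₀ ≤ (radAvg q (a + h) g x₀ + radAvg q (a - h) g x₀) / 2 + δ / 2 := by
    calc radAvg q a φ x₀ ≤ ∫ z, ((radWeight q z • g (x₀ + (a + h) • z)
          + radWeight q z • g (x₀ + (a - h) • z)) / 2 + radWeight q z * (δ / (2 * m₀))) := by
          refine integral_mono (hq.integrable_radWeight_smul hφ.continuous a x₀) hsum fun z => ?_
          dsimp only
          simp only [smul_eq_mul]
          rcases eq_or_ne (radWeight q z) 0 with h | h
          · simp [h]
          · have := mul_le_mul_of_nonneg_left (hpt z (hq.norm_le_one h)) (hq.radWeight_nonneg z)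
            linarith
      _ = (radAvg q (a + h) g x₀ + radAvg q (a - h) g x₀) / 2 + m₀ * (δ / (2 * m₀)) := by
          rw [integral_add (((hgi (a + h)).fun_add (hgi (a - h))).div_const 2) hci,
            integral_div, integral_add (hgi (a + h)) (hgi (a - h)), integral_mul_const]
          rfl
      _ = _ := by field_simp
  have hbb : ∀ b, a / 2 ≤ b → b ≤ a + h → radAvg q b g x₀ ≤ radAvg q b φ x₀ + δ / 2 := by
    intro b hb1 hb2
    have hb0 : 0 < b := by linarith
    have h1 := hq.norm_fderiv_radAvg_sub_le (r := s) (c := x₀) hφ hφc hK hb0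
      measurableSet_ball hMφ fun y hy => closedBall_subset_ball' (by
        rw [mem_closedBall] at hy; linarith)
    have h2 : K * (b ^ 2)⁻¹ * M ≤ L := by
      rw [hL]
      gcongr
    have h3 := hq.radAvg_le_add (hrd b) (c := x₀) hs.le hL0 fun y hy z hz =>
      (h1 y hy z hz).trans (mul_le_mul_of_nonneg_right h2 (norm_nonneg _))
    rw [hg, radAvg_const_mul, hq.radAvg_comm hφ.continuous, ← div_eq_inv_mul, div_le_iff₀ hm₀]
    refine h3.trans ?_
    rw [mul_comm]
    gcongr
  have h1 := hbb (a + h) (by linarith) le_rfl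
  have h2 := hbb (a - h) (by linarith) (by linarith)
  linarith

end IsProfile

/-- A function which is locally midpoint convex has monotone derivative. -/
theorem monotoneOn_of_eventually_midpoint {P J : ℝ → ℝ} {ρ : ℝ}
    (hP : ∀ t ∈ Set.Ioo 0 ρ, HasDerivAt P (J t) t)
    (hmid : ∀ a ∈ Set.Ioo 0 ρ, ∀ᶠ h in 𝓝[>] 0, 2 * P a ≤ P (a + h) + P (a - h)) :
    MonotoneOn J (Set.Ioo 0 ρ) := by
  intro p hp q hq hpq
  by_contra! hlt
  have hpq' : p < q := lt_of_le_of_ne hpq (by rintro rfl; exact lt_irrefl _ hlt)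
  have hqp : 0 < q - p := sub_pos.2 hpq'
  set δ := (J p - J q) / (4 * (q - p)) with hδ
  have hδ0 : 0 < δ := div_pos (sub_pos.2 hlt) (by positivity)
  have hδe : 2 * δ * (q - p) = (J p - J q) / 2 := by rw [hδ]; field_simp; ring
  set c := (J p + 2 * δ * p + (J q + 2 * δ * q)) / 2 with hc
  have hsub : Set.Icc p q ⊆ Set.Ioo 0 ρ := fun t ht => ⟨hp.1.trans_le ht.1, ht.2.trans_lt hq.2⟩
  have hR : ∀ t ∈ Set.Icc p q,
      HasDerivAt (fun t => P t + δ * t ^ 2 - c * t) (J t + 2 * δ * t - c) t := by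
    intro t ht
    have h := ((hP t (hsub ht)).add (((hasDerivAt_id t).pow 2).const_mul δ)).sub
      ((hasDerivAt_id t).const_mul c)
    refine HasDerivAt.congr_deriv h ?_
    simp
    ring
  set R := fun t => P t + δ * t ^ 2 - c * t with hRdef
  obtain ⟨a, ha, hmax⟩ := isCompact_Icc.exists_isMaxOn (Set.nonempty_Icc.2 hpq)
    (fun t ht => (hR t ht).continuousAt.continuousWithinAt : ContinuousOn R (Set.Icc p q))
  have hap : a ≠ p := by
    rintro rfl
    have h1 := hmax.localize.hasFDerivWithinAt_nonpos (hR a ha).hasFDerivAt.hasFDerivWithinAt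
      (sub_mem_posTangentConeAt_of_segment_subset
        (segment_eq_Icc hpq ▸ Set.Subset.rfl : segment ℝ a q ⊆ Set.Icc a q))
    simp only [ContinuousLinearMap.toSpanSingleton_apply, smul_eq_mul] at h1
    nlinarith
  have haq : a ≠ q := by
    rintro rfl
    have h1 := hmax.localize.hasFDerivWithinAt_nonpos (hR a ha).hasFDerivAt.hasFDerivWithinAt
      (sub_mem_posTangentConeAt_of_segment_subset
        (segment_symm ℝ p a ▸ segment_eq_Icc hpq ▸ Set.Subset.rfl :
          segment ℝ a p ⊆ Set.Icc p a))
    simp only [ContinuousLinearMap.toSpanSingleton_apply, smul_eq_mul] at h1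
    nlinarith
  have h1 : 0 < a - p := sub_pos.2 (lt_of_le_of_ne ha.1 hap.symm)
  have h2 : 0 < q - a := sub_pos.2 (lt_of_le_of_ne ha.2 haq)
  have hev : ∀ᶠ h : ℝ in 𝓝[>] 0, h ∈ Set.Ioo 0 (min (a - p) (q - a)) :=
    Ioo_mem_nhdsGT (lt_min h1 h2)
  obtain ⟨h, hm, hh0, hh⟩ := ((hmid a (hsub ha)).and hev).exists
  obtain ⟨h3, h4⟩ := lt_min_iff.1 hh
  have m1 : R (a + h) ≤ R a := hmax (show a + h ∈ Set.Icc p q from ⟨by linarith, by linarith⟩)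
  have m2 : R (a - h) ≤ R a := hmax (show a - h ∈ Set.Icc p q from ⟨by linarith, by linarith⟩)
  simp only [hRdef] at m1 m2
  nlinarith [mul_pos hδ0 (pow_pos hh0 2)]

/-- Monotonicity of the limit of the derivatives of asymptotically midpoint convex functions. -/
theorem monotoneOn_of_tendsto_deriv {P D : ℕ → ℝ → ℝ} {J : ℝ → ℝ} {ρ B : ℝ}
    (hP : ∀ n, ∀ t ∈ Set.Ioo 0 ρ, HasDerivAt (P n) (D n t) t)
    (hD : ∀ n, ContinuousOn (D n) (Set.Ioo 0 ρ))
    (hB : ∀ n, ∀ t ∈ Set.Ioo 0 ρ, |D n t| ≤ B / t)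
    (hlim : ∀ t ∈ Set.Ioo 0 ρ, Tendsto (fun n => D n t) atTop (𝓝 (J t)))
    (hJ : ContinuousOn J (Set.Ioo 0 ρ))
    (hmid : ∀ a h δ : ℝ, 0 < a → 0 < h → h ≤ a / 2 → a + 3 * h < ρ → 0 < δ →
      ∀ᶠ n in atTop, P n a ≤ (P n (a + h) + P n (a - h)) / 2 + δ) :
    MonotoneOn J (Set.Ioo 0 ρ) := by
  rcases le_or_gt ρ 0 with hρ | hρ
  · rw [Set.Ioo_eq_empty (not_lt.2 hρ)]
    exact fun _ h => absurd h (Set.notMem_empty _)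
  set c := ρ / 2 with hc
  have hcI : c ∈ Set.Ioo 0 ρ := ⟨by positivity, by linarith⟩
  have hsub : ∀ t ∈ Set.Ioo 0 ρ, Set.uIcc c t ⊆ Set.Ioo 0 ρ := fun t ht =>
    Set.OrdConnected.uIcc_subset Set.ordConnected_Ioo hcI ht
  have hder : ∀ t ∈ Set.Ioo 0 ρ, HasDerivAt (fun t => ∫ s in c..t, J s) (J t) t := fun t ht =>
    intervalIntegral.integral_hasDerivAt_right ((hJ.mono (hsub t ht)).intervalIntegrable)
      (hJ.stronglyMeasurableAtFilter isOpen_Ioo t ht) (hJ.continuousAt (isOpen_Ioo.mem_nhds ht))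
  have hconv : ∀ t ∈ Set.Ioo 0 ρ,
      Tendsto (fun n => P n t - P n c) atTop (𝓝 (∫ s in c..t, J s)) := by
    intro t ht
    have hn : ∀ n, P n t - P n c = ∫ s in c..t, D n s := fun n =>
      (intervalIntegral.integral_eq_sub_of_hasDerivAt (fun s hs => hP n s (hsub t ht hs))
        (((hD n).mono (hsub t ht)).intervalIntegrable)).symm
    simp_rw [hn]
    have hmem : ∀ s ∈ Set.uIoc c t, s ∈ Set.Ioo 0 ρ := fun s hs =>
      hsub t ht (Set.uIoc_subset_uIcc hs)
    refine intervalIntegral.tendsto_integral_filter_of_dominated_convergence (fun s => B / s)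
      (Eventually.of_forall fun n => ?_) (Eventually.of_forall fun n => ?_) ?_ ?_
    · exact ((hD n).mono fun s hs => hmem s hs).aestronglyMeasurable measurableSet_uIoc
    · exact Eventually.of_forall fun s hs => hB n s (hmem s hs)
    · refine ContinuousOn.intervalIntegrable (ContinuousOn.div continuousOn_const continuousOn_id ?_)
      exact fun s hs => (hsub t ht hs).1.ne'
    · exact Eventually.of_forall fun s hs => hlim s (hmem s hs)
  refine monotoneOn_of_eventually_midpoint hder fun a ha => ?_
  have hev : ∀ᶠ h : ℝ in 𝓝[>] 0, h ∈ Set.Ioo 0 (min (a / 2) ((ρ - a) / 3)) :=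
    Ioo_mem_nhdsGT (lt_min (half_pos ha.1) (div_pos (sub_pos.2 ha.2) (by norm_num)))
  filter_upwards [hev] with h hh
  obtain ⟨h1, h2⟩ := lt_min_iff.1 hh.2
  have hh0 := hh.1
  have ha0 := ha.1
  refine le_of_forall_pos_le_add fun δ hδ => ?_
  have hl := (hconv a ha).const_mul 2
  have hr := ((hconv (a + h) ⟨by linarith, by linarith⟩).add
    (hconv (a - h) ⟨by linarith, by linarith⟩)).add_const δ
  refine le_of_tendsto_of_tendsto hl hr ?_
  filter_upwards [hmid a h (δ / 2) ha0 hh0 h1.le (by linarith) (by positivity)] with n hn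
  linarith

/-- The profile `q` transported to the disk of centre `c` and radius `a`. -/
def scaledProfile (q : ℝ → ℝ) (c : E2) (a : ℝ) (x : E2) : ℝ := q (‖a⁻¹ • (x - c)‖ ^ 2)

namespace IsProfile

variable {q : ℝ → ℝ}

theorem scaledProfile_nonneg (hq : IsProfile q) (c : E2) (a : ℝ) (x : E2) :
    0 ≤ scaledProfile q c a x := hq.nonneg _

theorem scaledProfile_le_one (hq : IsProfile q) (c : E2) (a : ℝ) (x : E2) :
    scaledProfile q c a x ≤ 1 := hq.le_one (by positivity)

theorem scaledProfile_eq_zero (hq : IsProfile q) {c : E2} {a : ℝ} (ha : 0 < a) {x : E2}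
    (hx : x ∉ ball c a) : scaledProfile q c a x = 0 := by
  refine hq.eq_zero _ ?_
  rw [mem_ball_iff_norm, not_lt] at hx
  rw [norm_smul, norm_inv, Real.norm_of_nonneg ha.le]
  refine one_le_pow₀ ?_
  rw [inv_mul_eq_div, one_le_div ha]
  exact hx

theorem continuous_scaledProfile (hq : IsProfile q) (c : E2) (a : ℝ) :
    Continuous (scaledProfile q c a) :=
  hq.smooth.continuous.comp (by fun_prop)

theorem testFun_scaledProfile (hq : IsProfile q) {c : E2} {a : ℝ} (ha : 0 < a) {Ω : Set E2}
    (h : closedBall c a ⊆ Ω) : TestFun Ω (scaledProfile q c a) := by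
  have hs : tsupport (scaledProfile q c a) ⊆ closedBall c a := by
    refine closure_minimal (fun x hx => ?_) isClosed_closedBall
    by_contra hx'
    exact hx (hq.scaledProfile_eq_zero ha fun h => hx' (ball_subset_closedBall h))
  exact ⟨hq.continuous_scaledProfile c a,
    (isCompact_closedBall c a).of_isClosed_subset (isClosed_tsupport _) hs, hs.trans h⟩

theorem integral_profile_mul_comp (q : ℝ → ℝ) (f : E2 → ℝ) (c : E2) {a : ℝ} (ha : 0 < a) :
    ∫ z, q (‖z‖ ^ 2) * f (c + a • z) = (a ^ 2)⁻¹ * ∫ x, scaledProfile q c a x * f x := by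
  have h1 := Measure.integral_comp_smul volume
    (fun y : E2 => scaledProfile q c a (c + y) * f (c + y)) a
  have h2 := integral_add_left_eq_self (μ := (volume : Measure E2))
    (fun x => scaledProfile q c a x * f x) c
  rw [h2, finrank_euclideanSpace_fin, abs_of_pos (by positivity), smul_eq_mul] at h1
  rw [← h1]
  refine integral_congr_ae (Eventually.of_forall fun z => ?_)
  simp only [scaledProfile, add_sub_cancel_left, smul_smul, inv_mul_cancel₀ ha.ne', one_smul]

theorem continuousOn_integral_scaledProfile (hq : IsProfile q) (ζ : Measure E2)
    [IsFiniteMeasure ζ] (c : E2) :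
    ContinuousOn (fun a => ∫ x, scaledProfile q c a x ∂ζ) (Set.Ioi 0) := by
  refine continuousOn_of_dominated (bound := fun _ => (1 : ℝ))
    (fun a _ => (hq.continuous_scaledProfile c a).aestronglyMeasurable)
    (fun a _ => Eventually.of_forall fun x => ?_) (integrable_const _)
    (Eventually.of_forall fun x => ?_)
  · rw [Real.norm_of_nonneg (hq.scaledProfile_nonneg c a x)]
    exact hq.scaledProfile_le_one c a x
  · refine hq.smooth.continuous.comp_continuousOn ?_
    exact ((ContinuousOn.smul (continuousOn_inv₀.mono fun a ha => (ne_of_gt ha))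
      continuousOn_const).norm).pow 2

end IsProfile

theorem integral_scaledProfile_mul_le {k : ℕ} {V : Evec k → ℝ} (hV0 : ∀ y, 0 ≤ V y) {ε : ℝ}
    (hε : 0 < ε) {u : E2 → Evec k} {Ω : Set E2} (hint : IntegrableOn (eDens V ε u) Ω) {M₀ : ℝ}
    (hbd : energy V ε u Ω ≤ M₀) {q : ℝ → ℝ} (hq : IsProfile q) (c : E2) (a : ℝ) :
    |∫ x in Ω, scaledProfile q c a x * (ε⁻¹ * V (u x))| ≤ M₀ := by
  have h0 : ∀ x, 0 ≤ scaledProfile q c a x * (ε⁻¹ * V (u x)) := fun x =>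
    mul_nonneg (hq.scaledProfile_nonneg c a x) (mul_nonneg (by positivity) (hV0 _))
  rw [abs_of_nonneg (integral_nonneg h0)]
  refine (integral_mono_of_nonneg (Eventually.of_forall h0) hint
    (Eventually.of_forall fun x => ?_)).trans hbd
  have h1 : 0 ≤ ε⁻¹ * V (u x) := mul_nonneg (by positivity) (hV0 _)
  have h2 : 0 ≤ ε / 2 * gradSq u x := mul_nonneg (by positivity) (gradSq_nonneg u x)
  have h3 := mul_le_mul_of_nonneg_right (hq.scaledProfile_le_one c a x) h1
  simp only [eDens]
  linarith

theorem integral_profile_mul_tr2_eq {k : ℕ} {V : Evec k → ℝ} {ε : ℝ} {u : E2 → Evec k}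
    {Ω : Set E2} {q : ℝ → ℝ} (hq : IsProfile q) {φ : E2 → ℝ} {c : E2} {r t : ℝ}
    (ht : t ∈ Set.Ioo 0 r) (hrΩ : ball c r ⊆ Ω)
    (htr : ∀ y ∈ ball c r, tr2 (hess φ y) = 2 * (ε⁻¹ * V (u y))) :
    t * ∫ z, q (‖z‖ ^ 2) * tr2 (hess φ (c + t • z))
      = 2 / t * ∫ x in Ω, scaledProfile q c t x * (ε⁻¹ * V (u x)) := by
  have h1 := IsProfile.integral_profile_mul_comp q (fun y => tr2 (hess φ y)) c ht.1
  have h2 : ∫ x in Ω, scaledProfile q c t x * (ε⁻¹ * V (u x))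
      = ∫ x, scaledProfile q c t x * (ε⁻¹ * V (u x)) := by
    refine setIntegral_eq_integral_of_forall_compl_eq_zero fun x hx => ?_
    rw [hq.scaledProfile_eq_zero ht.1 fun h => hx (hrΩ (ball_subset_ball ht.2.le h)), zero_mul]
  have h3 : ∫ x, scaledProfile q c t x * tr2 (hess φ x)
      = 2 * ∫ x, scaledProfile q c t x * (ε⁻¹ * V (u x)) := by
    rw [← integral_const_mul]
    refine integral_congr_ae (Eventually.of_forall fun x => ?_)
    by_cases hx : x ∈ ball c t
    · simp only [htr x (ball_subset_ball ht.2.le hx)]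
      ring
    · simp only [hq.scaledProfile_eq_zero ht.1 hx]
      ring
  rw [h1, h2, h3]
  have := ht.1.ne'
  field_simp

theorem setIntegral_norm_hess_le {k : ℕ} {V : Evec k → ℝ} (hV0 : ∀ y, 0 ≤ V y) {ε : ℝ}
    (hε : 0 < ε) {u : E2 → Evec k} {Ω : Set E2}
    (hint : IntegrableOn (eDens V ε u) Ω) {M₀ : ℝ} (hbd : energy V ε u Ω ≤ M₀)
    {φ : E2 → ℝ} {B : Set E2} (hB : MeasurableSet B)
    (hBΩ : B ⊆ Ω) (hle : ∀ y ∈ B, ‖hess φ y‖ ≤ 4 * eDens V ε u y) :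
    ∫ y in B, ‖hess φ y‖ ≤ 4 * M₀ := by
  have h1 : ∫ y in B, ‖hess φ y‖ ≤ ∫ y in B, 4 * eDens V ε u y := by
    refine integral_mono_of_nonneg (Eventually.of_forall fun y => ?_)
      ((hint.mono_set hBΩ).const_mul 4) ?_
    · exact norm_nonneg (E := E2 →L[ℝ] E2 →L[ℝ] ℝ) _
    · exact (ae_restrict_iff' hB).2 (Eventually.of_forall hle)
  have h2 : ∫ y in B, eDens V ε u y ≤ ∫ y in Ω, eDens V ε u y :=
    setIntegral_mono_set hint (Eventually.of_forall fun y => eDens_nonneg hV0 hε u y)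
      (LE.le.eventuallyLE hBΩ)
  rw [integral_const_mul] at h1
  have h3 : ∫ y in Ω, eDens V ε u y ≤ M₀ := hbd
  linarith

theorem eventually_volume_hess_le {k : ℕ} {V : Evec k → ℝ} (hV : IsMultiWell V)
    {Ω : Set E2} (hΩo : IsOpen Ω) (hΩb : IsBounded Ω) {M₀ : ℝ} (hM₀ : 0 < M₀)
    {ε : ℕ → ℝ} {u : ℕ → E2 → Evec k} (hε : ∀ n, 0 < ε n) (hε0 : Tendsto ε atTop (𝓝 0))
    (hsol : ∀ n, IsSolution V (ε n) Ω (u n))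
    (hint : ∀ n, IntegrableOn (eDens V (ε n) (u n)) Ω)
    (hbd : ∀ n, energy V (ε n) (u n) Ω ≤ M₀) {x₀ : E2} {ρ r κ m C : ℝ} (hr : 0 < r) (hrρ : r < ρ)
    (hρΩ : ball x₀ ρ ⊆ Ω) (hκ : 0 < κ) (hm : 0 < m) {φ : ℕ → E2 → ℝ}
    (hdir : ∀ n, ∀ y ∈ ball x₀ r, ∀ e : E2, ‖e‖ = 1 →
      (ε n)⁻¹ * V (u n y) - ε n / 2 * gradSq (u n) y ≤ hess (φ n) y e e)
    (htr : ∀ n, ∀ y ∈ ball x₀ r, tr2 (hess (φ n) y) = 2 * ((ε n)⁻¹ * V (u n y))) :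
    ∀ᶠ n in atTop, ∀ e : E2, ‖e‖ = 1 →
      volume {y ∈ ball x₀ r | hess (φ n) y e e ≤ -κ ∧ tr2 (hess (φ n) y) ≤ C}
        < ENNReal.ofReal m := by
  filter_upwards [eventually_volume_gradSq_ge_le hV hΩo hΩb hM₀ hε hε0 hsol hint hbd hr hrρ hρΩ
    (show 0 < 2 * κ by positivity) (half_pos hm) (C / 2)] with n hn e he
  refine (measure_mono ?_).trans_lt
    (hn.trans_lt ((ENNReal.ofReal_lt_ofReal_iff hm).2 (half_lt_self hm)))
  rintro y ⟨hy, h1, h2⟩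
  have h3 := hdir n y hy e he
  rw [htr n y hy] at h2
  have h4 : 0 ≤ (ε n)⁻¹ * V (u n y) := mul_nonneg (inv_nonneg.2 (hε n).le) (hV.nonneg _)
  refine ⟨hy, ?_, by linarith⟩
  have h5 : (ε n)⁻¹ * V (u n y) ≤ C / 2 := by linarith
  rwa [inv_mul_le_iff₀ (hε n), mul_comm] at h5

theorem monotoneOn_integral_scaledProfile_div {k : ℕ} {V : Evec k → ℝ} (hV : IsMultiWell V)
    {Ω : Set E2} (hΩo : IsOpen Ω) (hΩb : IsBounded Ω) {M₀ : ℝ} (hM₀ : 0 < M₀)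
    {ε : ℕ → ℝ} {u : ℕ → E2 → Evec k} (hε : ∀ n, 0 < ε n) (hε0 : Tendsto ε atTop (𝓝 0))
    (hsol : ∀ n, IsSolution V (ε n) Ω (u n))
    (hint : ∀ n, IntegrableOn (eDens V (ε n) (u n)) Ω)
    (hbd : ∀ n, energy V (ε n) (u n) Ω ≤ M₀) {ζ : Measure E2} [IsFiniteMeasure ζ]
    (hζ : ∀ f : E2 → ℝ, TestFun Ω f →
      Tendsto (fun n => ∫ x in Ω, f x * ((ε n)⁻¹ * V (u n x))) atTop (𝓝 (∫ x, f x ∂ζ)))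
    {x₀ : E2} {ρ r : ℝ} (hr : 0 < r) (hrρ : r < ρ) (hρΩ : ball x₀ ρ ⊆ Ω)
    {q : ℝ → ℝ} (hq : IsProfile q) :
    MonotoneOn (fun t => 2 / t * ∫ x, scaledProfile q x₀ t x ∂ζ) (Set.Ioo 0 r) := by
  have hrΩ : ball x₀ r ⊆ Ω := (ball_subset_ball hrρ.le).trans hρΩ
  choose φ hφ hφc hφp using fun n =>
    exists_stress_potential hV.smooth hV.nonneg (hε n) hΩo (hsol n) hr hrρ hρΩ
  have htr : ∀ n, ∀ y ∈ ball x₀ r, tr2 (hess (φ n) y) = 2 * ((ε n)⁻¹ * V (u n y)) :=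
    fun n y hy => (hφp n y hy).2.1
  have hM : ∀ n, ∫ y in ball x₀ r, ‖hess (φ n) y‖ ≤ 4 * M₀ := fun n =>
    setIntegral_norm_hess_le hV.nonneg (hε n) (hint n) (hbd n) measurableSet_ball hrΩ
      fun y hy => (hφp n y hy).2.2
  have heq := fun n t (ht : t ∈ Set.Ioo 0 r) =>
    integral_profile_mul_tr2_eq hq ht hrΩ (htr n)
  refine monotoneOn_of_tendsto_deriv (P := fun n t => radAvg q t (φ n) x₀) (B := 2 * M₀)
    (D := fun n t => t * ∫ z, q (‖z‖ ^ 2) * tr2 (hess (φ n) (x₀ + t • z)))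
    (fun n t _ => hq.hasDerivAt_radAvg (hφ n) (hφc n) x₀ t)
    (fun n => (continuous_id.mul
      (hq.continuous_integral_profile_mul (continuous_tr2.comp (continuous_hess (hφ n))) x₀)).continuousOn)
    (fun n t ht => ?_) (fun t ht => ?_) ?_ fun a h δ ha hh hha hah hδ => ?_
  · rw [heq n t ht, abs_mul, abs_of_pos (div_pos two_pos ht.1), mul_div_right_comm]
    exact mul_le_mul_of_nonneg_left
      (integral_scaledProfile_mul_le hV.nonneg (hε n) (hint n) (hbd n) hq x₀ t)
      (div_pos two_pos ht.1).le
  · simp_rw [fun n => heq n t ht]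
    refine (hζ _ (hq.testFun_scaledProfile ht.1 ?_)).const_mul _
    exact (closedBall_subset_ball ht.2).trans hrΩ
  · exact (continuousOn_const.div continuousOn_id fun t ht => ht.1.ne').mul
      ((hq.continuousOn_integral_scaledProfile ζ x₀).mono fun t ht => ht.1)
  · obtain ⟨C, hC, κ, hκ, m, hm, H⟩ := hq.exists_radAvg_midpoint (x₀ := x₀) (M := 4 * M₀)
      ha hh hha hah (by positivity) hδ
    filter_upwards [eventually_volume_hess_le (C := C) hV hΩo hΩb hM₀ hε hε0 hsol hint hbd hr hrρ
      hρΩ hκ hm (fun n y hy => (hφp n y hy).1) htr] with n hn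
    refine H (φ n) (hφ n) (hφc n) (fun y hy => ?_) (hM n) hn
    rw [htr n y hy]
    exact mul_nonneg two_pos.le (mul_nonneg (inv_nonneg.2 (hε n).le) (hV.nonneg _))

theorem isProfile_smoothTransition (j : ℕ) :
    IsProfile fun w => Real.smoothTransition ((j + 1 : ℝ) * (1 - w)) where
  smooth := Real.smoothTransition.contDiff.comp (by fun_prop)
  antitone := fun v w h => Real.smoothTransition.monotone
    (mul_le_mul_of_nonneg_left (by linarith) (by positivity))
  eq_zero := fun w hw => Real.smoothTransition.zero_of_nonpos
    (mul_nonpos_of_nonneg_of_nonpos (by positivity) (by linarith))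
  map_zero := Real.smoothTransition.one_of_one_le (by simp)

/-- Steep profiles approximate the indicator function of the disk. -/
theorem tendsto_integral_scaledProfile (ζ : Measure E2) [IsFiniteMeasure ζ] (c : E2) {a : ℝ}
    (ha : 0 < a) :
    Tendsto (fun j : ℕ => ∫ x, scaledProfile
      (fun w => Real.smoothTransition ((j + 1 : ℝ) * (1 - w))) c a x ∂ζ) atTop
      (𝓝 (ζ (ball c a)).toReal) := by
  have h0 : (ζ (ball c a)).toReal = ∫ x, (ball c a).indicator 1 x ∂ζ :=
    (integral_indicator_one measurableSet_ball).symm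
  rw [h0]
  refine tendsto_integral_of_dominated_convergence (fun _ => (1 : ℝ))
    (fun j => ((isProfile_smoothTransition j).continuous_scaledProfile c a).aestronglyMeasurable)
    (integrable_const _) (fun j => Eventually.of_forall fun x => ?_)
    (Eventually.of_forall fun x => ?_)
  · rw [Real.norm_of_nonneg ((isProfile_smoothTransition j).scaledProfile_nonneg c a x)]
    exact (isProfile_smoothTransition j).scaledProfile_le_one c a x
  · by_cases hx : x ∈ ball c a
    · rw [Set.indicator_of_mem hx]
      have h1 : ‖a⁻¹ • (x - c)‖ < 1 := by
        rw [norm_smul, norm_inv, Real.norm_of_nonneg ha.le, inv_mul_eq_div, div_lt_one ha]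
        exact mem_ball_iff_norm.1 hx
      have h2 : 0 < 1 - ‖a⁻¹ • (x - c)‖ ^ 2 :=
        sub_pos.2 (pow_lt_one₀ (norm_nonneg _) h1 two_ne_zero)
      obtain ⟨N, hN⟩ := exists_nat_gt (1 - ‖a⁻¹ • (x - c)‖ ^ 2)⁻¹
      refine tendsto_const_nhds.congr' ?_
      filter_upwards [eventually_ge_atTop N] with j hj
      refine (Real.smoothTransition.one_of_one_le ?_).symm
      have hj' : (N : ℝ) ≤ j := Nat.cast_le.2 hj
      have h3 : (1 - ‖a⁻¹ • (x - c)‖ ^ 2)⁻¹ ≤ (j : ℝ) + 1 := by linarith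
      exact (inv_le_iff_one_le_mul₀ h2).1 h3
    · rw [Set.indicator_of_notMem hx]
      simp_rw [fun j => (isProfile_smoothTransition j).scaledProfile_eq_zero ha hx]
      exact tendsto_const_nhds

section Limit

variable {k : ℕ} {V : Evec k → ℝ} {Ω : Set E2} {M₀ : ℝ} {ε : ℕ → ℝ} {u : ℕ → E2 → Evec k}
  {ζ : Measure E2} {x₀ : E2} {ρ : ℝ}

theorem div_mul_integral_scaledProfile_le (hV : IsMultiWell V)
    (hΩo : IsOpen Ω) (hΩb : IsBounded Ω) (hM₀ : 0 < M₀)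
    (hε : ∀ n, 0 < ε n) (hε0 : Tendsto ε atTop (𝓝 0))
    (hsol : ∀ n, IsSolution V (ε n) Ω (u n))
    (hint : ∀ n, IntegrableOn (eDens V (ε n) (u n)) Ω)
    (hbd : ∀ n, energy V (ε n) (u n) Ω ≤ M₀) [IsFiniteMeasure ζ]
    (hζ : ∀ f : E2 → ℝ, TestFun Ω f →
      Tendsto (fun n => ∫ x in Ω, f x * ((ε n)⁻¹ * V (u n x))) atTop (𝓝 (∫ x, f x ∂ζ)))
    (hρΩ : ball x₀ ρ ⊆ Ω) {q : ℝ → ℝ} (hq : IsProfile q) {s t : ℝ} (hs : 0 < s) (hst : s ≤ t)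
    (ht : t ≤ ρ) :
    2 / s * ∫ x, scaledProfile q x₀ s x ∂ζ ≤ 2 / t * ∫ x, scaledProfile q x₀ t x ∂ζ := by
  rcases hst.eq_or_lt with rfl | hst
  · exact le_rfl
  have hc : ContinuousOn (fun t => 2 / t * ∫ x, scaledProfile q x₀ t x ∂ζ) (Set.Ioi 0) :=
    (continuousOn_const.div continuousOn_id fun t ht => ne_of_gt ht).mul
      (hq.continuousOn_integral_scaledProfile ζ x₀)
  have hct : Tendsto (fun t => 2 / t * ∫ x, scaledProfile q x₀ t x ∂ζ) (𝓝[<] t)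
      (𝓝 (2 / t * ∫ x, scaledProfile q x₀ t x ∂ζ)) :=
    (hc.continuousAt (Ioi_mem_nhds (hs.trans hst))).tendsto.mono_left nhdsWithin_le_nhds
  refine ge_of_tendsto hct ?_
  filter_upwards [Ioo_mem_nhdsLT hst] with p hp
  have hp0 : 0 < p := hs.trans hp.1
  exact monotoneOn_integral_scaledProfile_div hV hΩo hΩb hM₀ hε hε0 hsol hint hbd hζ
    (r := (p + ρ) / 2) (by linarith [hp.2]) (by linarith [hp.2]) hρΩ hq
    ⟨hs, by linarith [hp.1, hp.2]⟩ ⟨hp0, by linarith [hp.2]⟩ hp.1.le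

theorem measure_ball_div_le_measure_ball_div (hV : IsMultiWell V)
    (hΩo : IsOpen Ω) (hΩb : IsBounded Ω) (hM₀ : 0 < M₀)
    (hε : ∀ n, 0 < ε n) (hε0 : Tendsto ε atTop (𝓝 0))
    (hsol : ∀ n, IsSolution V (ε n) Ω (u n))
    (hint : ∀ n, IntegrableOn (eDens V (ε n) (u n)) Ω)
    (hbd : ∀ n, energy V (ε n) (u n) Ω ≤ M₀) [IsFiniteMeasure ζ]
    (hζ : ∀ f : E2 → ℝ, TestFun Ω f →
      Tendsto (fun n => ∫ x in Ω, f x * ((ε n)⁻¹ * V (u n x))) atTop (𝓝 (∫ x, f x ∂ζ)))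
    (hρΩ : ball x₀ ρ ⊆ Ω) {s t : ℝ} (hs : 0 < s) (hst : s ≤ t) (ht : t ≤ ρ) :
    (ζ (ball x₀ s)).toReal / s ≤ (ζ (ball x₀ t)).toReal / t := by
  have h := le_of_tendsto_of_tendsto'
    ((tendsto_integral_scaledProfile ζ x₀ hs).const_mul (2 / s))
    ((tendsto_integral_scaledProfile ζ x₀ (hs.trans_le hst)).const_mul (2 / t)) fun j =>
    div_mul_integral_scaledProfile_le hV hΩo hΩb hM₀ hε hε0 hsol hint hbd hζ hρΩ
      (isProfile_smoothTransition j) hs hst ht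
  rw [div_mul_eq_mul_div, div_mul_eq_mul_div, mul_div_assoc, mul_div_assoc] at h
  linarith

theorem measure_ball_le (hV0 : ∀ y, 0 ≤ V y) (hε : ∀ n, 0 < ε n)
    (hint : ∀ n, IntegrableOn (eDens V (ε n) (u n)) Ω)
    (hbd : ∀ n, energy V (ε n) (u n) Ω ≤ M₀) [IsFiniteMeasure ζ]
    (hζ : ∀ f : E2 → ℝ, TestFun Ω f →
      Tendsto (fun n => ∫ x in Ω, f x * ((ε n)⁻¹ * V (u n x))) atTop (𝓝 (∫ x, f x ∂ζ)))
    (hρ : 0 < ρ) (hρΩ : ball x₀ ρ ⊆ Ω) : (ζ (ball x₀ ρ)).toReal ≤ M₀ := by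
  refine le_of_tendsto' (tendsto_integral_scaledProfile ζ x₀ hρ) fun j => ?_
  have hq := isProfile_smoothTransition j
  refine le_of_tendsto (((hq.continuousOn_integral_scaledProfile ζ x₀).continuousAt
    (Ioi_mem_nhds hρ)).tendsto.mono_left (nhdsWithin_le_nhds (s := Set.Iio ρ))) ?_
  filter_upwards [Ioo_mem_nhdsLT hρ] with t ht
  refine le_of_tendsto' (hζ _ (hq.testFun_scaledProfile ht.1
    ((closedBall_subset_ball ht.2).trans hρΩ))) fun n => ?_
  exact (le_abs_self _).trans
    (integral_scaledProfile_mul_le hV0 (hε n) (hint n) (hbd n) hq x₀ t)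

end Limit

/-- A nonnegative function which increases on `(0, ρ]` has a limit at `0`. -/
theorem exists_tendsto_nhdsGT_zero {g : ℝ → ℝ} {ρ : ℝ} (hρ : 0 < ρ) (h0 : ∀ r, 0 < r → 0 ≤ g r)
    (hg : ∀ r₀ r₁ : ℝ, 0 < r₀ → r₀ ≤ r₁ → r₁ ≤ ρ → g r₀ ≤ g r₁) :
    ∃ Θ : ℝ, Tendsto g (𝓝[>] 0) (𝓝 Θ) ∧ Θ ≤ g ρ := by
  have hm : MonotoneOn g (Set.Ioo 0 ρ) := fun a ha b hb hab => hg a b ha.1 hab hb.2.le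
  have hne : (Set.Ioo 0 ρ).Nonempty := Set.nonempty_Ioo.2 hρ
  have hb : BddBelow (g '' Set.Ioo 0 ρ) := ⟨0, by rintro _ ⟨r, hr, rfl⟩; exact h0 r hr.1⟩
  refine ⟨sInf (g '' Set.Ioo 0 ρ), ?_, ?_⟩
  · exact hm.tendsto_nhdsWithin_Ioo_right hne hb
  · obtain ⟨r, hr⟩ := hne
    exact (csInf_le hb ⟨r, hr, rfl⟩).trans (hg r ρ hr.1 hr.2.le le_rfl)

/-- monotonicity for the limiting potential measure. For
every disk `D(x₀,ρ) ⊆ Ω`, the quantity `ζ(D(x₀,r))/r` is nondecreasing in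
`r ∈ (0,ρ]`; consequently the one-dimensional density
`Θ⋆(x₀) = lim_{r→0} ζ(D(x₀,r))/r` exists and is bounded by
`ζ(D(x₀,ρ))/ρ ≤ M₀/dist(x₀,∂Ω)`. -/
theorem statement_8 (k : ℕ) (hk : 1 ≤ k) (V : Evec k → ℝ) (hV : IsMultiWell V)
    (Ω : Set E2) (hΩo : IsOpen Ω) (hΩb : IsBounded Ω)
    (M₀ : ℝ) (hM₀ : 0 < M₀)
    (ε : ℕ → ℝ) (u : ℕ → E2 → Evec k)
    (hε : ∀ n, 0 < ε n) (hε0 : Tendsto ε atTop (𝓝 0))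
    (hsol : ∀ n, IsSolution V (ε n) Ω (u n))
    (hint : ∀ n, IntegrableOn (eDens V (ε n) (u n)) Ω)
    (hbd : ∀ n, energy V (ε n) (u n) Ω ≤ M₀)
    (ν ζ : Measure E2) (hνfin : IsFiniteMeasure ν) (hζfin : IsFiniteMeasure ζ)
    (hνsupp : ν Ωᶜ = 0) (hζsupp : ζ Ωᶜ = 0)
    (hνconv : ∀ f : E2 → ℝ, TestFun Ω f →
      Tendsto (fun n => ∫ x in Ω, f x * eDens V (ε n) (u n) x) atTop
        (𝓝 (∫ x, f x ∂ν)))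
    (hζconv : ∀ f : E2 → ℝ, TestFun Ω f →
      Tendsto (fun n => ∫ x in Ω, f x * ((ε n)⁻¹ * V (u n x))) atTop
        (𝓝 (∫ x, f x ∂ζ)))
    (x₀ : E2) (hx₀ : x₀ ∈ Ω) (ρ : ℝ) (hρ : 0 < ρ) (hρΩ : ball x₀ ρ ⊆ Ω) :
    (∀ r₀ r₁ : ℝ, 0 < r₀ → r₀ ≤ r₁ → r₁ ≤ ρ →
      (ζ (ball x₀ r₀)).toReal / r₀ ≤ (ζ (ball x₀ r₁)).toReal / r₁) ∧
    ∃ Θ : ℝ, Tendsto (fun r : ℝ => (ζ (ball x₀ r)).toReal / r) (𝓝[>] 0) (𝓝 Θ) ∧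
      Θ ≤ (ζ (ball x₀ ρ)).toReal / ρ ∧
      (ζ (ball x₀ ρ)).toReal / ρ ≤ M₀ / infDist x₀ Ωᶜ := by
  have hmono : ∀ ρ' : ℝ, ball x₀ ρ' ⊆ Ω → ∀ r₀ r₁ : ℝ, 0 < r₀ → r₀ ≤ r₁ → r₁ ≤ ρ' →
      (ζ (ball x₀ r₀)).toReal / r₀ ≤ (ζ (ball x₀ r₁)).toReal / r₁ := fun ρ' hρ' r₀ r₁ h0 h01 h1 =>
    measure_ball_div_le_measure_ball_div hV hΩo hΩb hM₀ hε hε0 hsol hint hbd hζconv hρ' h0 h01 h1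
  obtain ⟨Θ, hΘ, hΘρ⟩ := exists_tendsto_nhdsGT_zero (g := fun r => (ζ (ball x₀ r)).toReal / r) hρ
    (fun r hr => div_nonneg ENNReal.toReal_nonneg hr.le) (hmono ρ hρΩ)
  refine ⟨hmono ρ hρΩ, Θ, hΘ, hΘρ, ?_⟩
  have hne : Ωᶜ.Nonempty := by
    rw [Set.nonempty_compl]
    rintro rfl
    exact NormedSpace.unbounded_univ ℝ E2 hΩb
  have hdρ : ρ ≤ infDist x₀ Ωᶜ := (le_infDist hne).2 fun y hy => by
    by_contra! h
    exact hy (hρΩ (by rwa [mem_ball, dist_comm]))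
  have hd : 0 < infDist x₀ Ωᶜ := hρ.trans_le hdρ
  have hdΩ : ball x₀ (infDist x₀ Ωᶜ) ⊆ Ω :=
    Set.disjoint_compl_right_iff_subset.1 disjoint_ball_infDist
  exact (hmono _ hdΩ ρ _ hρ hdρ le_rfl).trans
    (div_le_div_of_nonneg_right (measure_ball_le hV.nonneg hε hint hbd hζconv hd hdΩ) hd.le)
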